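/- arXiv:2401.17532 — 3 statements merged into one kernel-verified Lean document; each statement's English description precedes it below -/
import Mathlib

section
/- Let d ≥ 1 and let K : ℝ^d × ℝ^d → [0,∞) be measurable such that the operator T_K is universally L^p-improving. Let n ≥ 2 and let G be a tree on the vertex set {1,…,n} (a connected acyclic simple graph). Then there exist exponents p₁,…,pₙ ∈ (1,∞) with ∑_{i=1}^n 1/p_i > 1 and a constant C > 0 such that Λ_G^K(f₁,…,fₙ) ≤ C ∏_{i=1}^n ‖f_i‖_{L^{p_i}(ℝ^d)} for all nonnegative measurable f₁,…,fₙ : ℝ^d → [0,∞); that is, Λ_G^K is L^p-improving. -/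
open MeasureTheory ENNReal NNReal

noncomputable section

/-- The `L^p` norm (`p ∈ [1,∞]`) of a nonnegative function on `ℝ^d`. -/
def nnLpNorm' {d : ℕ} (p : ℝ≥0∞) (f : EuclideanSpace ℝ (Fin d) → ℝ≥0) : ℝ≥0∞ :=
  eLpNorm (fun x => (f x : ℝ)) p volume

/-- The `L^q` norm (`q ∈ [1,∞]`) of an `ℝ≥0∞`-valued function on `ℝ^d`. -/
def lpNormE {d : ℕ} (q : ℝ≥0∞) (g : EuclideanSpace ℝ (Fin d) → ℝ≥0∞) : ℝ≥0∞ :=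
  if q = ∞ then essSup g volume else (∫⁻ x, g x ^ q.toReal) ^ (1 / q.toReal)

/-- The operator `T_K f(x) = ∫ K(x,y) f(y) dy` for a nonnegative kernel and a
nonnegative function. -/
def TK {d : ℕ} (K : EuclideanSpace ℝ (Fin d) → EuclideanSpace ℝ (Fin d) → ℝ≥0)
    (f : EuclideanSpace ℝ (Fin d) → ℝ≥0) (x : EuclideanSpace ℝ (Fin d)) : ℝ≥0∞ :=
  ∫⁻ y, (K x y : ℝ≥0∞) * (f y : ℝ≥0∞)

/-- `T_K` is universally `L^p`-improving: for every `q ∈ (1,∞)` there are `p ∈ (1,q)`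
and `C > 0` such that `‖T_K f‖_q ≤ C ‖f‖_p` for all nonnegative measurable `f`. -/
def UnivImp {d : ℕ} (K : EuclideanSpace ℝ (Fin d) → EuclideanSpace ℝ (Fin d) → ℝ≥0) : Prop :=
  ∀ q : ℝ≥0∞, 1 < q → q < ∞ →
    ∃ p : ℝ≥0∞, 1 < p ∧ p < q ∧ ∃ C : ℝ, 0 < C ∧
      ∀ f : EuclideanSpace ℝ (Fin d) → ℝ≥0, Measurable f →
        lpNormE q (TK K f) ≤ ENNReal.ofReal C * nnLpNorm' p f

open Classical in
/-- The product of `K(x^i, x^j)` over the edges `{i,j} ∈ E(G)`, `i < j`. -/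
def edgeProd {d n : ℕ} (K : EuclideanSpace ℝ (Fin d) → EuclideanSpace ℝ (Fin d) → ℝ≥0)
    (G : SimpleGraph (Fin n)) (x : Fin n → EuclideanSpace ℝ (Fin d)) : ℝ≥0∞ :=
  ∏ i, ∏ j, if i < j ∧ G.Adj i j then (K (x i) (x j) : ℝ≥0∞) else 1

/-- The multilinear form `Λ_G^K(f₁,…,fₙ)`. -/
def lamForm {d n : ℕ} (K : EuclideanSpace ℝ (Fin d) → EuclideanSpace ℝ (Fin d) → ℝ≥0)
    (G : SimpleGraph (Fin n)) (f : Fin n → EuclideanSpace ℝ (Fin d) → ℝ≥0) : ℝ≥0∞ :=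
  ∫⁻ x : Fin n → EuclideanSpace ℝ (Fin d), edgeProd K G x * ∏ i, (f i (x i) : ℝ≥0∞)

/-- The `L^p` norm, for a real exponent, of an `ℝ≥0∞`-valued function. -/
def rpowNorm {α : Type*} [MeasureSpace α] (p : ℝ) (f : α → ℝ≥0∞) : ℝ≥0∞ :=
  (∫⁻ x, f x ^ p) ^ (1 / p)

/-- The kernel `k` improves integrability with arbitrarily large target exponents. -/
def ImprovesAtLargeExponents {α : Type*} [MeasureSpace α] (k : α → α → ℝ≥0∞) : Prop :=
  ∀ R : ℝ, 1 ≤ R → ∃ r s : ℝ, 1 < s ∧ s < r ∧ R < r ∧ ∃ C : ℝ≥0∞, C ≠ ∞ ∧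
    ∀ f : α → ℝ≥0∞, Measurable f →
      rpowNorm r (fun x => ∫⁻ y, k x y * f y) ≤ C * rpowNorm s f

/-- Converse Hölder inequality. -/
theorem rpowNorm_le_of_forall_lintegral_mul_le {α : Type*} [MeasureSpace α]
    [SigmaFinite (volume : Measure α)] {p q : ℝ} (hpq : p.HolderConjugate q)
    {h : α → ℝ≥0∞} (hh : Measurable h) {A : ℝ≥0∞}
    (hA : ∀ f : α → ℝ≥0, Measurable f →
      ∫⁻ x, (f x : ℝ≥0∞) * h x ≤ A * rpowNorm p (fun x => (f x : ℝ≥0∞))) :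
    rpowNorm q h ≤ A := by
  have hp0 := hpq.pos
  have hq0 := hpq.symm.pos
  have hq1 := hpq.symm.lt
  let S := spanningSets (volume : Measure α)
  let g : ℕ → α → ℝ≥0∞ := fun n => (S n).indicator fun x => min (h x) n ^ q
  have hgm : ∀ n, Measurable (g n) := fun n =>
    ((hh.min measurable_const).pow_const q).indicator (measurableSet_spanningSets _ n)
  have hbound : ∀ n, ∫⁻ x, g n x ≤ A ^ q := by
    intro n
    let f : α → ℝ≥0 := fun x => ((S n).indicator (fun x => min (h x) n ^ (q - 1)) x).toNNReal
    have hfm : Measurable f :=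
      (((hh.min measurable_const).pow_const (q - 1)).indicator
        (measurableSet_spanningSets _ n)).ennreal_toNNReal
    have hfc : ∀ x, (f x : ℝ≥0∞) = (S n).indicator (fun x => min (h x) n ^ (q - 1)) x := by
      intro x
      refine ENNReal.coe_toNNReal ?_
      by_cases hx : x ∈ S n
      · rw [Set.indicator_of_mem hx]
        exact ENNReal.rpow_ne_top_of_nonneg (by linarith)
          (ne_top_of_le_ne_top (ENNReal.natCast_ne_top n) (min_le_right _ _))
      · simp [hx]
    have hfp : ∀ x, (f x : ℝ≥0∞) ^ p = g n x := by
      intro x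
      rw [hfc]
      by_cases hx : x ∈ S n
      · simp only [g, Set.indicator_of_mem hx]
        rw [← ENNReal.rpow_mul, hpq.symm.sub_one_mul_conj]
      · simp [g, hx, hp0]
    have hgf : ∀ x, g n x ≤ f x * h x := by
      intro x
      rw [hfc]
      by_cases hx : x ∈ S n
      · simp only [g, Set.indicator_of_mem hx]
        calc min (h x) n ^ q = min (h x) n ^ (q - 1 + 1) := by ring_nf
          _ = min (h x) n ^ (q - 1) * min (h x) n := by
            rw [ENNReal.rpow_add_of_nonneg _ _ (by linarith) zero_le_one, ENNReal.rpow_one]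
          _ ≤ _ := by gcongr; exact min_le_left _ _
      · simp [g, hx]
    have hfin : ∫⁻ x, g n x ≠ ∞ := by
      have : ∫⁻ x, g n x ≤ (n : ℝ≥0∞) ^ q * volume (S n) := by
        rw [lintegral_indicator (measurableSet_spanningSets _ n)]
        calc _ ≤ ∫⁻ x in S n, (n : ℝ≥0∞) ^ q := by
              gcongr; exact min_le_right _ _
          _ = _ := by simp
      refine ne_top_of_le_ne_top (ENNReal.mul_ne_top ?_ (measure_spanningSets_lt_top _ n).ne) this
      exact ENNReal.rpow_ne_top_of_nonneg hq0.le (ENNReal.natCast_ne_top n)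
    have key : ∫⁻ x, g n x ≤ A * (∫⁻ x, g n x) ^ (1 / p) := by
      calc ∫⁻ x, g n x ≤ ∫⁻ x, f x * h x := lintegral_mono hgf
        _ ≤ _ := hA f hfm
        _ = _ := by simp only [rpowNorm, hfp]
    generalize ∫⁻ x, g n x = I at hfin key
    rcases eq_or_ne I 0 with rfl | hI
    · exact zero_le
    have h1 : 1 / p + 1 / q = 1 := by simpa using hpq.inv_add_inv_eq_one
    have hne0 : I ^ (1 / p) ≠ 0 := by simp [ENNReal.rpow_eq_zero_iff, hI, hfin]
    have hnet : I ^ (1 / p) ≠ ∞ := ENNReal.rpow_ne_top_of_nonneg (by positivity) hfin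
    have : I ^ (1 / q) ≤ A := by
      rw [← ENNReal.mul_le_mul_iff_left hne0 hnet, ← ENNReal.rpow_add _ _ hI hfin, add_comm, h1,
        ENNReal.rpow_one]
      exact key
    calc I = (I ^ (1 / q)) ^ q := by
          rw [← ENNReal.rpow_mul, one_div_mul_cancel hq0.ne', ENNReal.rpow_one]
      _ ≤ A ^ q := by gcongr
  have hlim : ∀ x, Filter.Tendsto (fun n => g n x) Filter.atTop (nhds (h x ^ q)) := by
    intro x
    have h1 : Filter.Tendsto (fun n : ℕ => min (h x) (n : ℝ≥0∞) ^ q) Filter.atTop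
        (nhds (h x ^ q)) := by
      have : Filter.Tendsto (fun n : ℕ => min (h x) (n : ℝ≥0∞)) Filter.atTop
          (nhds (min (h x) ∞)) := tendsto_const_nhds.min ENNReal.tendsto_nat_nhds_top
      rw [min_eq_left le_top] at this
      exact (ENNReal.continuous_rpow_const.tendsto _).comp this
    refine h1.congr' ?_
    have hx : x ∈ ⋃ n, S n := by simp [S, iUnion_spanningSets]
    obtain ⟨N, hN⟩ := Set.mem_iUnion.1 hx
    filter_upwards [Filter.eventually_ge_atTop N] with n hn
    simp [g, monotone_spanningSets _ hn hN, S]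
  have hle : ∫⁻ x, h x ^ q ≤ A ^ q := by
    calc ∫⁻ x, h x ^ q = ∫⁻ x, Filter.liminf (fun n => g n x) Filter.atTop := by
          simp_rw [(hlim _).liminf_eq]
      _ ≤ Filter.liminf (fun n => ∫⁻ x, g n x) Filter.atTop := lintegral_liminf_le hgm
      _ ≤ Filter.limsup (fun n => ∫⁻ x, g n x) Filter.atTop := Filter.liminf_le_limsup
      _ ≤ A ^ q := Filter.limsup_le_of_le (h := .of_forall hbound)
  calc rpowNorm q h ≤ (A ^ q) ^ (1 / q) := by unfold rpowNorm; gcongr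
    _ = A := by rw [← ENNReal.rpow_mul, mul_one_div_cancel hq0.ne', ENNReal.rpow_one]

theorem nnLpNorm'_eq_rpowNorm {d : ℕ} {p : ℝ≥0∞} (hp0 : p ≠ 0) (hp : p ≠ ∞)
    (f : EuclideanSpace ℝ (Fin d) → ℝ≥0) :
    nnLpNorm' p f = rpowNorm p.toReal fun x => (f x : ℝ≥0∞) := by
  simp [nnLpNorm', rpowNorm, eLpNorm_eq_lintegral_rpow_enorm_toReal hp0 hp, enorm_eq_nnnorm]

theorem UnivImp.exists_rpowNorm_le {d : ℕ}
    {K : EuclideanSpace ℝ (Fin d) → EuclideanSpace ℝ (Fin d) → ℝ≥0} (hTK : UnivImp K)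
    {q : ℝ} (hq : 1 < q) :
    ∃ p : ℝ, 1 < p ∧ p < q ∧ ∃ C : ℝ≥0∞, C ≠ ∞ ∧ C ≠ 0 ∧
      ∀ f : EuclideanSpace ℝ (Fin d) → ℝ≥0, Measurable f →
        rpowNorm q (fun x => ∫⁻ y, (K x y : ℝ≥0∞) * f y) ≤
          C * rpowNorm p fun x => (f x : ℝ≥0∞) := by
  obtain ⟨p, hp1, hpq, C, hC, h⟩ := hTK (ENNReal.ofReal q) (by simpa using hq) (by simp)
  have hpt : p ≠ ∞ := (hpq.trans (by simp)).ne
  refine ⟨p.toReal, ?_, ?_, ENNReal.ofReal C, by simp, by simpa using hC, fun f hf => ?_⟩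
  · simpa using (ENNReal.toReal_lt_toReal (by simp) hpt).2 hp1
  · exact (ENNReal.lt_ofReal_iff_toReal_lt hpt).1 hpq
  · have := h f hf
    rw [nnLpNorm'_eq_rpowNorm (by positivity) hpt, lpNormE, if_neg (by simp),
      ENNReal.toReal_ofReal (by linarith)] at this
    exact this

theorem UnivImp.improvesAtLargeExponents {d : ℕ}
    {K : EuclideanSpace ℝ (Fin d) → EuclideanSpace ℝ (Fin d) → ℝ≥0} (hTK : UnivImp K) :
    ImprovesAtLargeExponents fun x y => (K x y : ℝ≥0∞) := by
  intro R hR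
  obtain ⟨s, hs1, hs, C, hC, hC0, h⟩ := hTK.exists_rpowNorm_le (q := R + 1) (by linarith)
  refine ⟨R + 1, s, hs1, hs, by linarith, C, hC, fun f hf => ?_⟩
  by_cases hfin : ∫⁻ x, f x ^ s = ∞
  · rw [rpowNorm.eq_1 s, hfin, ENNReal.top_rpow_of_pos (by positivity), ENNReal.mul_top hC0]
    exact le_top
  have hae : ∀ᵐ x, ((f x).toNNReal : ℝ≥0∞) = f x := by
    filter_upwards [ae_lt_top (hf.pow_const s) hfin] with x hx
    refine ENNReal.coe_toNNReal fun hx' => ?_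
    rw [hx', ENNReal.top_rpow_of_pos (by positivity)] at hx
    exact hx.ne rfl
  have h1 := h (fun x => (f x).toNNReal) hf.ennreal_toNNReal
  have h2 : ∀ x, ∫⁻ y, (K x y : ℝ≥0∞) * (f y).toNNReal = ∫⁻ y, (K x y : ℝ≥0∞) * f y :=
    fun x => lintegral_congr_ae (hae.mono fun y hy => by simp only [hy])
  have h3 : rpowNorm s (fun x => ((f x).toNNReal : ℝ≥0∞)) = rpowNorm s f := by
    have : (fun x => ((f x).toNNReal : ℝ≥0∞) ^ s) =ᵐ[volume] fun x => f x ^ s :=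
      hae.mono fun y hy => by simp only [hy]
    simp only [rpowNorm, lintegral_congr_ae this]
  simpa only [h2, h3] using h1

theorem UnivImp.improvesAtLargeExponents_flip {d : ℕ}
    {K : EuclideanSpace ℝ (Fin d) → EuclideanSpace ℝ (Fin d) → ℝ≥0}
    (hK : Measurable fun p : EuclideanSpace ℝ (Fin d) × EuclideanSpace ℝ (Fin d) => K p.1 p.2)
    (hTK : UnivImp K) :
    ImprovesAtLargeExponents fun x y => (K y x : ℝ≥0∞) := by
  intro R hR
  have hR1 : 1 < R + 1 := by linarith
  have hc := Real.HolderConjugate.conjExponent hR1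
  obtain ⟨p, hp1, hpq, C, hC, -, h⟩ := hTK.exists_rpowNorm_le hc.symm.lt
  have hc' := Real.HolderConjugate.conjExponent hp1
  have hlt : R + 1 < p.conjExponent := by
    have h1 := hc.inv_add_inv_eq_one
    have h2 := hc'.inv_add_inv_eq_one
    have h3 := inv_strictAnti₀ hc'.pos hpq
    exact (inv_lt_inv₀ hc'.symm.pos hc.pos).1 (by linarith)
  refine ⟨p.conjExponent, R + 1, hR1, hlt, by linarith, C, hC, fun g hg => ?_⟩
  have hm : Measurable fun z : EuclideanSpace ℝ (Fin d) × EuclideanSpace ℝ (Fin d) =>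
      (K z.2 z.1 : ℝ≥0∞) * g z.2 :=
    (hK.comp measurable_swap).coe_nnreal_ennreal.mul (hg.comp measurable_snd)
  refine rpowNorm_le_of_forall_lintegral_mul_le hc' hm.lintegral_prod_right' fun f hf => ?_
  have hTm : Measurable fun y => ∫⁻ x, (K y x : ℝ≥0∞) * f x :=
    (hK.coe_nnreal_ennreal.mul
      (hf.comp measurable_snd).coe_nnreal_ennreal).lintegral_prod_right'
  calc ∫⁻ x, (f x : ℝ≥0∞) * ∫⁻ y, (K y x : ℝ≥0∞) * g y
      = ∫⁻ x, ∫⁻ y, (f x : ℝ≥0∞) * ((K y x : ℝ≥0∞) * g y) := by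
        congr with x
        rw [lintegral_const_mul' _ _ ENNReal.coe_ne_top]
    _ = ∫⁻ y, ∫⁻ x, (f x : ℝ≥0∞) * ((K y x : ℝ≥0∞) * g y) := by
        refine lintegral_lintegral_swap ?_
        exact ((hf.comp measurable_fst).coe_nnreal_ennreal.mul hm).aemeasurable
    _ = ∫⁻ y, g y * ∫⁻ x, (K y x : ℝ≥0∞) * f x := by
        congr with y
        rw [← lintegral_const_mul]
        · congr with x
          ring
        · exact ((hK.comp measurable_prodMk_left).coe_nnreal_ennreal.mul
            hf.coe_nnreal_ennreal)
    _ ≤ rpowNorm (R + 1) g * rpowNorm (R + 1).conjExponent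
          (fun y => ∫⁻ x, (K y x : ℝ≥0∞) * f x) :=
        ENNReal.lintegral_mul_le_Lp_mul_Lq volume hc hg.aemeasurable hTm.aemeasurable
    _ ≤ rpowNorm (R + 1) g * (C * rpowNorm p fun x => (f x : ℝ≥0∞)) := by
        gcongr
        exact h f hf
    _ = _ := by ring

theorem measurable_edgeProd {d n : ℕ}
    {K : EuclideanSpace ℝ (Fin d) → EuclideanSpace ℝ (Fin d) → ℝ≥0}
    (hK : Measurable fun p : EuclideanSpace ℝ (Fin d) × EuclideanSpace ℝ (Fin d) => K p.1 p.2)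
    (G : SimpleGraph (Fin n)) : Measurable (edgeProd K G) := by
  unfold edgeProd
  refine Finset.measurable_prod _ fun i _ => Finset.measurable_prod _ fun j _ => ?_
  split_ifs
  · have hij : Measurable fun x : Fin n → EuclideanSpace ℝ (Fin d) => (x i, x j) :=
      (measurable_pi_apply i).prodMk (measurable_pi_apply j)
    exact (hK.comp hij).coe_nnreal_ennreal
  · exact measurable_const

/-- Removing a leaf of a tree on `Fin (n + 2)` leaves a tree on `Fin (n + 1)`. -/
theorem SimpleGraph.IsTree.exists_leaf_succAbove {n : ℕ} {G : SimpleGraph (Fin (n + 2))}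
    (hG : G.IsTree) : ∃ (l : Fin (n + 2)) (u : Fin (n + 1)),
      (∀ j, G.Adj l (l.succAbove j) ↔ j = u) ∧ (G.comap l.succAbove).IsTree := by
  classical
  obtain ⟨l, hl⟩ := hG.exists_vert_degree_one_of_nontrivial
  have hconn := hG.connected.induce_compl_singleton_of_degree_eq_one hl
  obtain ⟨w, hw, huniq⟩ := SimpleGraph.degree_eq_one_iff_existsUnique_adj.1 hl
  obtain ⟨u, rfl⟩ := Fin.exists_succAbove_eq hw.ne'
  refine ⟨l, u, fun j => ⟨fun hj => Fin.succAbove_right_injective (huniq _ hj), ?_⟩, ?_, ?_⟩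
  · rintro rfl
    exact hw
  · let e : G.comap l.succAbove ≃g G.induce {l}ᶜ :=
      { toEquiv := finSuccAboveEquiv l
        map_rel_iff' := Iff.rfl }
    exact e.connected_iff.2 hconn
  · exact hG.isAcyclic.comap (SimpleGraph.Hom.comap l.succAbove G)
      Fin.succAbove_right_injective

/-- The edge product splits off the unique edge at a leaf. -/
theorem edgeProd_insertNth {d n : ℕ}
    (K : EuclideanSpace ℝ (Fin d) → EuclideanSpace ℝ (Fin d) → ℝ≥0)
    (G : SimpleGraph (Fin (n + 1))) (l : Fin (n + 1)) (u : Fin n)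
    (hl : ∀ j, G.Adj l (l.succAbove j) ↔ j = u) (a : EuclideanSpace ℝ (Fin d))
    (y : Fin n → EuclideanSpace ℝ (Fin d)) :
    edgeProd K G (l.insertNth a y : Fin (n + 1) → EuclideanSpace ℝ (Fin d)) =
      edgeProd K (G.comap l.succAbove) y *
        if l < l.succAbove u then (K a (y u) : ℝ≥0∞) else (K (y u) a : ℝ≥0∞) := by
  classical
  unfold edgeProd
  rw [Fin.prod_univ_succAbove _ l]
  simp_rw [Fin.prod_univ_succAbove _ l]
  simp only [Fin.insertNth_apply_same, Fin.insertNth_apply_succAbove, lt_self_iff_false,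
    false_and, if_false, one_mul, SimpleGraph.comap_adj, (Fin.strictMono_succAbove l).lt_iff_lt,
    hl, G.adj_comm (l.succAbove _) l]
  rw [Finset.prod_mul_distrib, ← mul_assoc, ← Finset.prod_mul_distrib, mul_comm]
  congr 1
  rw [Finset.prod_eq_single u]
  · rcases (Fin.succAbove_ne l u).lt_or_gt with h | h <;> simp [h, h.not_gt]
  · intro j _ hj
    simp [hj]
  · simp

/-- Integrating out a leaf. -/
theorem lintegral_edgeProd_mul_prod_eq {d n : ℕ}
    {K : EuclideanSpace ℝ (Fin d) → EuclideanSpace ℝ (Fin d) → ℝ≥0}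
    (hK : Measurable fun p : EuclideanSpace ℝ (Fin d) × EuclideanSpace ℝ (Fin d) => K p.1 p.2)
    (G : SimpleGraph (Fin (n + 1))) (l : Fin (n + 1)) (u : Fin n)
    (hl : ∀ j, G.Adj l (l.succAbove j) ↔ j = u)
    {k : EuclideanSpace ℝ (Fin d) → EuclideanSpace ℝ (Fin d) → ℝ≥0∞}
    (hk : ∀ x a, k x a = if l < l.succAbove u then (K a x : ℝ≥0∞) else (K x a : ℝ≥0∞))
    (hkm : Measurable fun p : EuclideanSpace ℝ (Fin d) × EuclideanSpace ℝ (Fin d) => k p.1 p.2)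
    {f : Fin (n + 1) → EuclideanSpace ℝ (Fin d) → ℝ≥0∞} (hf : ∀ i, Measurable (f i)) :
    ∫⁻ x : Fin (n + 1) → EuclideanSpace ℝ (Fin d), edgeProd K G x * ∏ i, f i (x i) =
      ∫⁻ y : Fin n → EuclideanSpace ℝ (Fin d), edgeProd K (G.comap l.succAbove) y *
        ∏ i, f (l.succAbove i) (y i) * if i = u then ∫⁻ a, k (y i) a * f l a else 1 := by
  have hmp := (volume_preserving_piFinSuccAbove
    (fun _ : Fin (n + 1) => EuclideanSpace ℝ (Fin d)) l).symm
  have hFm : Measurable fun x : Fin (n + 1) → EuclideanSpace ℝ (Fin d) =>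
      edgeProd K G x * ∏ i, f i (x i) :=
    (measurable_edgeProd hK G).mul
      (Finset.measurable_prod _ fun i _ => (hf i).comp (measurable_pi_apply i))
  rw [← hmp.lintegral_comp hFm, Measure.volume_eq_prod,
    lintegral_prod_symm]
  swap
  · exact (hFm.comp hmp.measurable).aemeasurable
  congr with y
  have h1 : ∀ a, edgeProd K G (l.insertNth a y : Fin (n + 1) → EuclideanSpace ℝ (Fin d)) *
      ∏ i, f i ((l.insertNth a y : Fin (n + 1) → EuclideanSpace ℝ (Fin d)) i) =
      (edgeProd K (G.comap l.succAbove) y * ∏ i, f (l.succAbove i) (y i)) *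
        (k (y u) a * f l a) := by
    intro a
    rw [edgeProd_insertNth K G l u hl, Fin.prod_univ_succAbove _ l, hk]
    simp only [Fin.insertNth_apply_same, Fin.insertNth_apply_succAbove]
    ring
  calc _ = ∫⁻ a, (edgeProd K (G.comap l.succAbove) y * ∏ i, f (l.succAbove i) (y i)) *
        (k (y u) a * f l a) := lintegral_congr h1
    _ = _ := by
      have hm : Measurable fun a => k (y u) a * f l a :=
        (hkm.comp measurable_prodMk_left).mul (hf l)
      rw [lintegral_const_mul _ hm,
        Finset.prod_mul_distrib, Finset.prod_ite_eq', if_pos (Finset.mem_univ u), mul_assoc]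

theorem exists_lintegral_edgeProd_mul_prod_le {d : ℕ}
    {K : EuclideanSpace ℝ (Fin d) → EuclideanSpace ℝ (Fin d) → ℝ≥0}
    (hK : Measurable fun p : EuclideanSpace ℝ (Fin d) × EuclideanSpace ℝ (Fin d) => K p.1 p.2)
    (hTK : UnivImp K) (n : ℕ) : ∀ G : SimpleGraph (Fin (n + 1)), G.IsTree →
    ∃ p : Fin (n + 1) → ℝ, (∀ i, 1 ≤ p i) ∧ 1 ≤ ∑ i, (p i)⁻¹ ∧
      (0 < n → (∀ i, 1 < p i) ∧ 1 < ∑ i, (p i)⁻¹) ∧ ∃ C : ℝ≥0∞, C ≠ ∞ ∧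
      ∀ f : Fin (n + 1) → EuclideanSpace ℝ (Fin d) → ℝ≥0∞, (∀ i, Measurable (f i)) →
        ∫⁻ x : Fin (n + 1) → EuclideanSpace ℝ (Fin d), edgeProd K G x * ∏ i, f i (x i) ≤
          C * ∏ i, rpowNorm (p i) (f i) := by
  induction n with
  | zero =>
    intro G _
    refine ⟨fun _ => 1, by simp, by simp, by simp, 1, by simp, fun f hf => ?_⟩
    have hmp := volume_preserving_funUnique (Fin 1) (EuclideanSpace ℝ (Fin d))
    simp only [edgeProd, rpowNorm, Fin.prod_univ_succ, Finset.univ_eq_empty, Finset.prod_empty,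
      lt_self_iff_false, false_and, if_false, mul_one, one_mul, ENNReal.rpow_one, div_one]
    exact (hmp.lintegral_comp (hf 0)).le
  | succ n ih =>
    intro G hG
    obtain ⟨l, u, hl, hG'⟩ := hG.exists_leaf_succAbove
    obtain ⟨p, hp1, hpsum, hpn, C, hC, hbound⟩ := ih _ hG'
    obtain ⟨k, hk, hkm, hkimp⟩ :
        ∃ k : EuclideanSpace ℝ (Fin d) → EuclideanSpace ℝ (Fin d) → ℝ≥0∞,
          (∀ x a, k x a = if l < l.succAbove u then (K a x : ℝ≥0∞) else (K x a : ℝ≥0∞)) ∧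
          (Measurable fun p : EuclideanSpace ℝ (Fin d) × EuclideanSpace ℝ (Fin d) =>
            k p.1 p.2) ∧ ImprovesAtLargeExponents k := by
      by_cases h : l < l.succAbove u
      · exact ⟨fun x a => K a x, by simp [h], (hK.comp measurable_swap).coe_nnreal_ennreal,
          hTK.improvesAtLargeExponents_flip hK⟩
      · exact ⟨fun x a => K x a, by simp [h], hK.coe_nnreal_ennreal,
          hTK.improvesAtLargeExponents⟩
    obtain ⟨r, s, hs1, hsr, hRr, D, hD, hT⟩ := hkimp (p u) (hp1 u)
    have hpu0 : 0 < p u := by linarith [hp1 u]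
    have hr0 : 0 < r := by linarith
    have hinv : r⁻¹ < (p u)⁻¹ := inv_strictAnti₀ hpu0 hRr
    have hrinv : 0 < r⁻¹ := inv_pos.2 hr0
    have hsinv : r⁻¹ < s⁻¹ := inv_strictAnti₀ (by linarith) hsr
    let t : ℝ := ((p u)⁻¹ - r⁻¹)⁻¹
    have hput : p u < t := (lt_inv_comm₀ hpu0 (by linarith)).2 (by linarith)
    let p' : Fin (n + 1) → ℝ := fun i => if i = u then t else p i
    have hp' : ∀ i, 1 < p' i := by
      intro i
      by_cases hi : i = u
      · simp only [p', hi, if_true]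
        linarith [hp1 u]
      · simp only [p', hi, if_false]
        refine (hpn ?_).1 i
        by_contra h0
        obtain rfl : n = 0 := by omega
        exact hi (Subsingleton.elim (α := Fin 1) _ _)
    have hsum' : ∑ i, (p' i)⁻¹ = ∑ i, (p i)⁻¹ - r⁻¹ := by
      have : ∀ i, (p' i)⁻¹ = (p i)⁻¹ - if i = u then r⁻¹ else 0 := by
        intro i
        by_cases hi : i = u <;> simp [p', t, hi]
      simp [this, Finset.sum_sub_distrib]
    let P : Fin (n + 1 + 1) → ℝ := l.insertNth s p'
    have hP : ∀ i, 1 < P i := by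
      rw [Fin.forall_iff_succAbove l]
      simpa [P] using ⟨hs1, hp'⟩
    have hPsum : 1 < ∑ i, (P i)⁻¹ := by
      rw [Fin.sum_univ_succAbove _ l]
      simp only [P, Fin.insertNth_apply_same, Fin.insertNth_apply_succAbove, hsum']
      linarith
    refine ⟨P, fun i => (hP i).le, hPsum.le, fun _ => ⟨hP, hPsum⟩, C * D,
      ENNReal.mul_ne_top hC hD, fun f hf => ?_⟩
    let T : EuclideanSpace ℝ (Fin d) → ℝ≥0∞ := fun x => ∫⁻ a, k x a * f l a
    have hTm : Measurable T := (hkm.mul ((hf l).comp measurable_snd)).lintegral_prod_right'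
    let F : Fin (n + 1) → EuclideanSpace ℝ (Fin d) → ℝ≥0∞ := fun i x =>
      f (l.succAbove i) x * if i = u then T x else 1
    have hFm : ∀ i, Measurable (F i) := by
      intro i
      refine (hf _).mul ?_
      split_ifs
      · exact hTm
      · exact measurable_const
    have hFnorm : ∀ i, rpowNorm (p i) (F i) ≤ rpowNorm (p' i) (f (l.succAbove i)) *
        if i = u then D * rpowNorm s (f l) else 1 := by
      intro i
      by_cases hi : i = u
      · subst hi
        simp only [F, p', if_true]
        calc _ ≤ rpowNorm t (f (l.succAbove i)) * rpowNorm r T :=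
              ENNReal.lintegral_Lp_mul_le_Lq_mul_Lr hpu0 hput (by simp [t]) volume
                (hf _).aemeasurable hTm.aemeasurable
          _ ≤ _ := by
            gcongr
            exact hT _ (hf l)
      · simp [F, p', hi]
    rw [lintegral_edgeProd_mul_prod_eq hK G l u hl hk hkm hf]
    calc _ ≤ C * ∏ i, rpowNorm (p i) (F i) := hbound F hFm
      _ ≤ C * ∏ i, (rpowNorm (p' i) (f (l.succAbove i)) *
          if i = u then D * rpowNorm s (f l) else 1) := by
        gcongr with i
        exact hFnorm i
      _ = _ := by
        rw [Finset.prod_mul_distrib, Finset.prod_ite_eq', if_pos (Finset.mem_univ u),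
          Fin.prod_univ_succAbove _ l]
        simp only [P, Fin.insertNth_apply_same, Fin.insertNth_apply_succAbove]
        ring

/-- **Trees.** If `T_K` is universally `L^p`-improving and `G` is a tree on `n ≥ 2`
vertices, then `Λ_G^K` is `L^p`-improving: there are exponents `p₁,…,pₙ ∈ (1,∞)` with
`∑ 1/pᵢ > 1` and a constant `C > 0` such that
`Λ_G^K(f₁,…,fₙ) ≤ C ∏ ‖fᵢ‖_{L^{pᵢ}}` for all nonnegative measurable `fᵢ`. -/
theorem tree_form_Lp_improving (d n : ℕ) (hd : 1 ≤ d) (hn : 2 ≤ n)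
    (K : EuclideanSpace ℝ (Fin d) → EuclideanSpace ℝ (Fin d) → ℝ≥0)
    (hK : Measurable fun p : EuclideanSpace ℝ (Fin d) × EuclideanSpace ℝ (Fin d) => K p.1 p.2)
    (hTK : UnivImp K)
    (G : SimpleGraph (Fin n)) (hG : G.IsTree) :
    ∃ (p : Fin n → ℝ≥0∞) (C : ℝ), 0 < C ∧ (∀ i, 1 < p i ∧ p i < ∞) ∧
      1 < ∑ i, (p i)⁻¹ ∧
      ∀ f : Fin n → EuclideanSpace ℝ (Fin d) → ℝ≥0, (∀ i, Measurable (f i)) →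
        lamForm K G f ≤ ENNReal.ofReal C * ∏ i, nnLpNorm' (p i) (f i) := by
  obtain ⟨m, rfl⟩ : ∃ m, n = m + 1 := ⟨n - 1, by omega⟩
  obtain ⟨p, -, -, hp, C, hC, h⟩ := exists_lintegral_edgeProd_mul_prod_le hK hTK m G hG
  obtain ⟨hp1, hsum⟩ := hp (by omega)
  have hp0 : ∀ i, 0 < p i := fun i => by linarith [hp1 i]
  refine ⟨fun i => ENNReal.ofReal (p i), C.toReal + 1, by positivity, fun i => ⟨?_, by simp⟩,
    ?_, fun f hf => ?_⟩
  · simpa using hp1 i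
  · simp_rw [← ENNReal.ofReal_inv_of_pos (hp0 _)]
    rw [← ENNReal.ofReal_sum_of_nonneg fun i _ => (inv_pos.2 (hp0 i)).le]
    simpa using hsum
  · have h2 : ∀ i, nnLpNorm' (ENNReal.ofReal (p i)) (f i) =
        rpowNorm (p i) fun x => (f i x : ℝ≥0∞) := by
      intro i
      rw [nnLpNorm'_eq_rpowNorm (by simpa using hp0 i) (by simp),
        ENNReal.toReal_ofReal (hp0 i).le]
    simp_rw [h2]
    refine (h (fun i x => f i x) fun i => (hf i).coe_nnreal_ennreal).trans ?_
    gcongr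
    rw [ENNReal.le_ofReal_iff_toReal_le hC (by positivity)]
    linarith
end
end

section
/- Let d ≥ 1 and let K : ℝ^d × ℝ^d → [0,∞) be measurable such that T_K is universally L^p-improving. Let n ≥ 2 and let G be a tree on {1,…,n} with root at vertex 1, with edge set E(G). For nonnegative measurable f₂,…,fₙ : ℝ^d → [0,∞) define U(x) = ∫_{(ℝ^d)^{n−1}} ∏_{{i,j}∈E(G), i<j} K(x^i,x^j) ∏_{i=2}^n f_i(x^i) dx^2 ⋯ dx^n, where in the product one substitutes x^1 = x. Then for every q ∈ [1,∞) there exist exponents p₁,…,pₙ ∈ (1,∞) with ∑_{i=1}^n 1/p_i > 1/q and a constant C > 0 such that ‖f₁ · U‖_{L^q(ℝ^d)} ≤ C ∏_{i=1}^n ‖f_i‖_{L^{p_i}(ℝ^d)} for all nonnegative measurable f₁,…,fₙ. -/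
open MeasureTheory ENNReal NNReal

noncomputable section

/-- The family of variables obtained by substituting `x` for the coordinate `i0`. -/
def extendAt {d n : ℕ} (i0 : Fin n) (x : EuclideanSpace ℝ (Fin d))
    (z : {i : Fin n // i ≠ i0} → EuclideanSpace ℝ (Fin d)) (i : Fin n) :
    EuclideanSpace ℝ (Fin d) :=
  if h : i = i0 then x else z ⟨i, h⟩

/-- `U(x)`: the integral over all variables except the root variable `x^{i0} = x`, of the
product of the kernel over the edges of `G` times `∏_{i ≠ i0} f i (x^i)`. -/
def Ufun {d n : ℕ} (K : EuclideanSpace ℝ (Fin d) → EuclideanSpace ℝ (Fin d) → ℝ≥0)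
    (G : SimpleGraph (Fin n)) (i0 : Fin n) (f : Fin n → EuclideanSpace ℝ (Fin d) → ℝ≥0)
    (x : EuclideanSpace ℝ (Fin d)) : ℝ≥0∞ :=
  ∫⁻ z : {i : Fin n // i ≠ i0} → EuclideanSpace ℝ (Fin d),
    edgeProd K G (extendAt i0 x z) * ∏ i : {i : Fin n // i ≠ i0}, ((f i (z i) : ℝ≥0∞))

/-- The `L^{1/a}` norm of an `ℝ≥0∞`-valued function, parametrized by the inverse exponent `a`. -/
def lpInvNorm {α : Type*} [MeasurableSpace α] (μ : Measure α) (a : ℝ) (f : α → ℝ≥0∞) : ℝ≥0∞ :=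
  (∫⁻ x, f x ^ (1 / a) ∂μ) ^ a

/-- The integral operator with kernel `k` is bounded from `L^{1/c}` to `L^{1/b}`. -/
def KernelBound {α : Type*} [MeasurableSpace α] (μ : Measure α) (k : α → α → ℝ≥0∞)
    (b c : ℝ) : Prop :=
  ∃ C : ℝ≥0, 0 < C ∧ ∀ f : α → ℝ≥0∞, Measurable f →
    lpInvNorm μ b (fun x => ∫⁻ y, k x y * f y ∂μ) ≤ C * lpInvNorm μ c f

theorem lpInvNorm_mul_le {α : Type*} [MeasurableSpace α] {μ : Measure α} {a b : ℝ}
    (ha : 0 < a) (hb : 0 < b) {f g : α → ℝ≥0∞} (hf : Measurable f) (hg : Measurable g) :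
    lpInvNorm μ (a + b) (fun x => f x * g x) ≤ lpInvNorm μ a f * lpInvNorm μ b g := by
  have h := ENNReal.lintegral_Lp_mul_le_Lq_mul_Lr (p := 1 / (a + b)) (q := 1 / a) (r := 1 / b)
    (by positivity) (one_div_lt_one_div_of_lt ha (by linarith)) (by simp) μ
    hf.aemeasurable hg.aemeasurable
  simpa [lpInvNorm] using h

theorem lintegral_mul_le_lpInvNorm {α : Type*} [MeasurableSpace α] {μ : Measure α} {b : ℝ}
    (hb : 0 < b) (hb1 : b < 1) {f g : α → ℝ≥0∞} (hf : Measurable f) (hg : Measurable g) :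
    ∫⁻ x, f x * g x ∂μ ≤ lpInvNorm μ b f * lpInvNorm μ (1 - b) g := by
  have h := lpInvNorm_mul_le (μ := μ) hb (sub_pos.2 hb1) hf hg
  simpa [lpInvNorm] using h

theorem lpInvNorm_le_of_forall_lintegral_mul_le {α : Type*} [MeasurableSpace α] {μ : Measure α}
    [SigmaFinite μ] {c : ℝ} (hc : 0 < c) (hc1 : c < 1) {h : α → ℝ≥0∞} (hh : Measurable h)
    {M : ℝ≥0∞} (H : ∀ f : α → ℝ≥0∞, Measurable f → ∫⁻ x, h x * f x ∂μ ≤ M * lpInvNorm μ c f) :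
    lpInvNorm μ (1 - c) h ≤ M := by
  have hc' : 0 < 1 - c := sub_pos.2 hc1
  set r : ℝ := 1 / (1 - c) with hr
  have hr0 : 0 < r := by positivity
  let t : ℕ → α → ℝ≥0∞ := fun n => (spanningSets μ n).indicator fun x => min (h x) n
  have ht_meas : ∀ n, Measurable (t n) := fun n =>
    (hh.min measurable_const).indicator (measurableSet_spanningSets μ n)
  have ht_le : ∀ n x, t n x ≤ h x := fun n x =>
    (Set.indicator_le_self' (fun _ _ => zero_le) x).trans (min_le_left _ _)
  have ht_mono : ∀ x, Monotone fun n => t n x := fun x n m hnm => by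
    refine (Set.indicator_le_indicator_of_subset (monotone_spanningSets μ hnm)
      (fun _ => zero_le) x).trans (Set.indicator_le_indicator ?_)
    exact min_le_min_left _ (by exact_mod_cast hnm)
  have ht_tendsto : ∀ x, Filter.Tendsto (fun n => t n x) Filter.atTop (nhds (h x)) := fun x => by
    have h1 : Filter.Tendsto (fun n : ℕ => min (h x) n) Filter.atTop (nhds (min (h x) ⊤)) :=
      tendsto_const_nhds.min ENNReal.tendsto_nat_nhds_top
    rw [min_eq_left le_top] at h1
    refine h1.congr' ?_
    filter_upwards [eventually_mem_spanningSets μ x] with n hn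
    simp [t, hn]
  have ht_fin : ∀ n, ∫⁻ x, t n x ^ r ∂μ ≠ ⊤ := fun n => by
    have : ∫⁻ x, t n x ^ r ∂μ ≤ ∫⁻ x in spanningSets μ n, (n : ℝ≥0∞) ^ r ∂μ := by
      rw [← lintegral_indicator (measurableSet_spanningSets μ n)]
      refine lintegral_mono fun x => ?_
      by_cases hx : x ∈ spanningSets μ n
      · simp only [t, hx, Set.indicator_of_mem]
        gcongr
        exact min_le_right _ _
      · simp [t, hx, hr0]
    refine ne_top_of_le_ne_top ?_ this
    rw [setLIntegral_const]
    exact ENNReal.mul_ne_top (ENNReal.rpow_ne_top_of_nonneg hr0.le (by simp))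
      (measure_spanningSets_lt_top μ n).ne
  have hI : ∀ n, ∫⁻ x, t n x ^ r ∂μ ≤ M ^ r := fun n => by
    set I := ∫⁻ x, t n x ^ r ∂μ with hIdef
    have h1 : I ≤ M * I ^ c := by
      have h2 := H (fun x => t n x ^ (r - 1)) ((ht_meas n).pow_const _)
      have h3 : lpInvNorm μ c (fun x => t n x ^ (r - 1)) = I ^ c := by
        rw [lpInvNorm, hIdef]
        congr 2
        ext x
        rw [← ENNReal.rpow_mul]
        congr 1
        rw [hr]; field_simp; ring
      rw [h3] at h2
      refine le_trans (lintegral_mono fun x => ?_) h2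
      have hr1 : 0 < r - 1 := by
        rw [hr, sub_pos, lt_div_iff₀ hc']; linarith
      calc t n x ^ r = t n x ^ (1 + (r - 1)) := by congr 1; ring
        _ = t n x * t n x ^ (r - 1) := by
          rw [ENNReal.rpow_add_of_nonneg _ _ zero_le_one hr1.le, ENNReal.rpow_one]
        _ ≤ h x * t n x ^ (r - 1) := by gcongr; exact ht_le n x
    rcases eq_or_ne I 0 with h0 | h0
    · simp [h0]
    have h4 : I ^ (1 - c) ≤ M := by
      rw [ENNReal.rpow_sub _ _ h0 (ht_fin n), ENNReal.rpow_one]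
      exact ENNReal.div_le_of_le_mul h1
    calc I = (I ^ (1 - c)) ^ r := by
          rw [← ENNReal.rpow_mul, hr, mul_one_div_cancel hc'.ne', ENNReal.rpow_one]
      _ ≤ M ^ r := by gcongr
  have hlim := lintegral_tendsto_of_tendsto_of_monotone (μ := μ) (f := fun n x => t n x ^ r)
    (F := fun x => h x ^ r) (fun n => ((ht_meas n).pow_const _).aemeasurable)
    (Filter.Eventually.of_forall fun x n m hnm => by
      have := ht_mono x hnm
      dsimp only at this ⊢
      gcongr)
    (Filter.Eventually.of_forall fun x =>
      (ENNReal.continuous_rpow_const.tendsto _).comp (ht_tendsto x))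
  have h5 : ∫⁻ x, h x ^ r ∂μ ≤ M ^ r := le_of_tendsto' hlim hI
  calc lpInvNorm μ (1 - c) h = (∫⁻ x, h x ^ r ∂μ) ^ (1 - c) := rfl
    _ ≤ (M ^ r) ^ (1 - c) := by gcongr
    _ = M := by rw [← ENNReal.rpow_mul, hr, one_div_mul_cancel hc'.ne', ENNReal.rpow_one]

/-- The transposed kernel is bounded between the dual exponents. -/
theorem KernelBound.transpose {α : Type*} [MeasurableSpace α] {μ : Measure α} [SigmaFinite μ]
    {k : α → α → ℝ≥0∞} (hk : Measurable fun p : α × α => k p.1 p.2) {b c : ℝ}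
    (hb : 0 < b) (hb1 : b < 1) (hc : 0 < c) (hc1 : c < 1) (h : KernelBound μ k b c) :
    KernelBound μ (fun x y => k y x) (1 - c) (1 - b) := by
  obtain ⟨C, hC, H⟩ := h
  refine ⟨C, hC, fun g hg => ?_⟩
  have hkg : Measurable fun p : α × α => k p.2 p.1 * g p.2 :=
    (hk.comp measurable_swap).mul (hg.comp measurable_snd)
  refine lpInvNorm_le_of_forall_lintegral_mul_le hc hc1 hkg.lintegral_prod_right' fun f hf => ?_
  have hkf : Measurable fun p : α × α => k p.1 p.2 * f p.2 := hk.mul (hf.comp measurable_snd)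
  calc ∫⁻ y, (∫⁻ x, k x y * g x ∂μ) * f y ∂μ
      = ∫⁻ y, ∫⁻ x, k x y * g x * f y ∂μ ∂μ := by
        refine lintegral_congr fun y => (lintegral_mul_const _ ?_).symm
        exact hkg.comp measurable_prodMk_left
    _ = ∫⁻ x, ∫⁻ y, k x y * g x * f y ∂μ ∂μ :=
        lintegral_lintegral_swap (hkg.mul (hf.comp measurable_fst)).aemeasurable
    _ = ∫⁻ x, (∫⁻ y, k x y * f y ∂μ) * g x ∂μ := by
        refine lintegral_congr fun x => ?_
        rw [← lintegral_mul_const (g x) (f := fun y => k x y * f y)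
          (hkf.comp measurable_prodMk_left)]
        exact lintegral_congr fun y => by ring
    _ ≤ lpInvNorm μ b (fun x => ∫⁻ y, k x y * f y ∂μ) * lpInvNorm μ (1 - b) g :=
        lintegral_mul_le_lpInvNorm hb hb1 hkf.lintegral_prod_right' hg
    _ ≤ C * lpInvNorm μ c f * lpInvNorm μ (1 - b) g := by gcongr; exact H f hf
    _ = C * lpInvNorm μ (1 - b) g * lpInvNorm μ c f := by ring

theorem exists_adjacent_extension {V : Type*} {G : SimpleGraph V} [DecidableEq V]
    (hG : G.IsTree) {S : Finset V} (hne : S.Nonempty) {v : V} (hv : v ∉ S)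
    (hS : (G.induce (S : Set V)).Preconnected) :
    ∃ m ∈ S, ∃ l ∉ S, G.Adj m l ∧ (∀ j ∈ S, G.Adj j l → j = m) ∧
      (G.induce ((insert l S : Finset V) : Set V)).Preconnected := by
  obtain ⟨r, hr⟩ := hne
  obtain ⟨p⟩ := hG.connected.preconnected r v
  obtain ⟨e, -, hm, hl⟩ := p.exists_boundary_dart (S : Set V) hr hv
  refine ⟨e.fst, hm, e.snd, hl, e.adj, fun j hj hjl => ?_, ?_⟩
  · obtain ⟨w, hw⟩ := (hS ⟨j, hj⟩ ⟨e.fst, hm⟩).exists_isPath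
    let w' : G.Walk j e.fst := w.map (SimpleGraph.Embedding.induce (S : Set V)).toHom
    have hw' : w'.IsPath :=
      hw.map (SimpleGraph.Embedding.induce (G := G) (S : Set V)).injective
    have hlw : e.snd ∉ w'.support := by
      intro hmem
      have h0 : e.snd ∈ w.support.map (SimpleGraph.Embedding.induce (G := G) (S : Set V)) := by
        have := w.support_map (SimpleGraph.Embedding.induce (G := G) (S : Set V)).toHom
        exact this ▸ hmem
      obtain ⟨a, -, ha⟩ := List.mem_map.1 h0
      exact hl (ha ▸ a.2)
    by_contra hne
    have h1 : (w'.cons hjl.symm).IsPath := hw'.cons hlw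
    have h2 : (SimpleGraph.Walk.nil.cons e.adj.symm : G.Walk e.snd e.fst).IsPath := by
      simp [e.adj.ne']
    have h3 := (hG.isAcyclic.subsingleton_path e.snd e.fst).elim ⟨_, h1⟩ ⟨_, h2⟩
    have h4 := congrArg (fun q => SimpleGraph.Walk.snd q.1) h3
    simp at h4
    exact hne h4
  · have := SimpleGraph.induce_union_connected
      (SimpleGraph.induce_pair_connected_of_adj e.adj).preconnected hS ⟨e.fst, by simp, hm⟩
    have heq : ((insert e.snd S : Finset V) : Set V) = {e.fst, e.snd} ∪ (S : Set V) := by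
      ext x
      simp only [Finset.coe_insert, Set.mem_insert_iff, Set.mem_union, Set.mem_singleton_iff]
      grind
    rw [heq]
    exact this.preconnected

theorem UnivImp.exists_kernelBound {d : ℕ}
    {K : EuclideanSpace ℝ (Fin d) → EuclideanSpace ℝ (Fin d) → ℝ≥0} (hTK : UnivImp K)
    {b : ℝ} (hb : 0 < b) (hb1 : b < 1) :
    ∃ c, b < c ∧ c < 1 ∧ KernelBound volume (fun x y => (K x y : ℝ≥0∞)) b c := by
  obtain ⟨p, hp1, hpq, C, hC, H⟩ := hTK (ENNReal.ofReal (1 / b))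
    (by rw [ENNReal.one_lt_ofReal]; exact (one_lt_div hb).2 hb1) ENNReal.ofReal_lt_top
  have hp_top : p ≠ ⊤ := (hpq.trans ENNReal.ofReal_lt_top).ne
  have hp0 : p ≠ 0 := (zero_lt_one.trans hp1).ne'
  have hp1' : 1 < p.toReal := by
    simpa using (ENNReal.toReal_lt_toReal ENNReal.one_ne_top hp_top).2 hp1
  have hpq' : p.toReal < 1 / b := by
    have := (ENNReal.toReal_lt_toReal hp_top ENNReal.ofReal_ne_top).2 hpq
    rwa [ENNReal.toReal_ofReal (by positivity)] at this
  have hc : 0 < 1 / p.toReal := by positivity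
  refine ⟨1 / p.toReal, ?_, ?_, C.toNNReal, by simpa using hC, fun f hf => ?_⟩
  · rwa [lt_one_div hb (by positivity)]
  · rw [div_lt_one (by positivity)]; exact hp1'
  by_cases hfin : lpInvNorm volume (1 / p.toReal) f = ⊤
  · rw [hfin, ENNReal.mul_top (by simpa using hC)]
    exact le_top
  have hf_ae : ∀ᵐ x, f x < ⊤ := by
    have h1 : ∫⁻ x, f x ^ p.toReal ≠ ⊤ := fun h => hfin (by simp [lpInvNorm, h]; linarith)
    filter_upwards [ae_lt_top (hf.pow_const _) h1] with x hx
    rwa [ENNReal.rpow_lt_top_iff_of_pos (by linarith)] at hx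
  have h2 : (fun x => ((f x).toNNReal : ℝ≥0∞)) =ᵐ[volume] f := by
    filter_upwards [hf_ae] with x hx using ENNReal.coe_toNNReal hx.ne
  have h3 := H (fun x => (f x).toNNReal) hf.ennreal_toNNReal
  have h4 : ∀ x, TK K (fun x => (f x).toNNReal) x = ∫⁻ y, (K x y : ℝ≥0∞) * f y := fun x => by
    refine lintegral_congr_ae ?_
    filter_upwards [h2] with y hy
    rw [hy]
  have h5 : nnLpNorm' p (fun x => (f x).toNNReal) = lpInvNorm volume (1 / p.toReal) f := by
    rw [nnLpNorm', eLpNorm_eq_lintegral_rpow_enorm_toReal hp0 hp_top, lpInvNorm]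
    congr 1
    refine lintegral_congr_ae ?_
    filter_upwards [h2] with y hy
    simp [hy]
  rw [h5] at h3
  rw [lpNormE, if_neg ENNReal.ofReal_ne_top, ENNReal.toReal_ofReal (by positivity)] at h3
  simp only [h4, one_div_one_div] at h3
  simp only [lpInvNorm, one_div_one_div] at h3 ⊢
  exact h3

section RootedIntegral

variable {ι : Type*} [LinearOrder ι] {α : Type*}

/-- The kernel `K` along the edge `{m, l}`, as a function of the variables at `m` and `l`. -/
def orientedKernel (K : α → α → ℝ≥0∞) (m l : ι) (u v : α) : ℝ≥0∞ :=
  if m < l then K u v else K v u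

theorem measurable_orientedKernel [MeasurableSpace α] {K : α → α → ℝ≥0∞}
    (hK : Measurable fun p : α × α => K p.1 p.2) (m l : ι) :
    Measurable fun p : α × α => orientedKernel K m l p.1 p.2 := by
  unfold orientedKernel
  split_ifs
  · exact hK
  · exact hK.comp measurable_swap

variable [Fintype ι]

open Classical in
/-- The product of the kernel over the edges of `G` with both ends in `S`. -/
def subgraphProd (K : α → α → ℝ≥0∞) (G : SimpleGraph ι) (S : Finset ι) (x : ι → α) : ℝ≥0∞ :=
  ∏ e : ι × ι with e.1 < e.2 ∧ G.Adj e.1 e.2 ∧ e.1 ∈ S ∧ e.2 ∈ S, K (x e.1) (x e.2)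

theorem subgraphProd_insert (K : α → α → ℝ≥0∞) {G : SimpleGraph ι} {S : Finset ι} {m l : ι}
    (hm : m ∈ S) (hl : l ∉ S) (hml : G.Adj m l) (huniq : ∀ j ∈ S, G.Adj j l → j = m)
    (x : ι → α) :
    subgraphProd K G (insert l S) x = subgraphProd K G S x * orientedKernel K m l (x m) (x l) := by
  classical
  have hne : m ≠ l := hml.ne
  have hset : (Finset.univ.filter fun e : ι × ι => e.1 < e.2 ∧ G.Adj e.1 e.2 ∧
        e.1 ∈ insert l S ∧ e.2 ∈ insert l S) =
      insert (if m < l then (m, l) else (l, m)) (Finset.univ.filter fun e : ι × ι =>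
        e.1 < e.2 ∧ G.Adj e.1 e.2 ∧ e.1 ∈ S ∧ e.2 ∈ S) := by
    ext ⟨i, j⟩
    have hs : ∀ a b, G.Adj a b → G.Adj b a := fun a b h => h.symm
    have hi : ∀ a, ¬ G.Adj a a := fun a => G.irrefl
    simp only [Finset.mem_filter, Finset.mem_univ, true_and, Finset.mem_insert]
    split_ifs <;> simp only [Prod.mk.injEq] <;> grind
  unfold subgraphProd orientedKernel
  rw [hset, Finset.prod_insert, mul_comm]
  · split_ifs <;> rfl
  · split_ifs <;> simp [hl]

variable [MeasurableSpace α]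

theorem measurable_subgraphProd {K : α → α → ℝ≥0∞}
    (hK : Measurable fun p : α × α => K p.1 p.2) (G : SimpleGraph ι) (S : Finset ι) :
    Measurable (subgraphProd K G S) := by
  unfold subgraphProd
  exact Finset.measurable_fun_prod _ fun e _ =>
    hK.comp (f := fun x : ι → α => (x e.1, x e.2))
      ((measurable_pi_apply e.1).prodMk (measurable_pi_apply e.2))

/-- The integral, over the variables in `S` other than the root `r`, of the product of the kernel
over the edges within `S` times the weights `f i` for `i ∈ S`. -/
def rootedIntegral (μ : Measure α) (K : α → α → ℝ≥0∞) (G : SimpleGraph ι) (r : ι) (S : Finset ι)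
    (f : ι → α → ℝ≥0∞) : (ι → α) → ℝ≥0∞ :=
  ∫⋯∫⁻_S.erase r, (fun x => subgraphProd K G S x * ∏ i ∈ S, f i (x i)) ∂fun _ => μ

/-- The weighted `L^{1/s}` estimate at the root `r` for the subtree with vertex set `S`, with
positive inverse exponents `a i` whose sum exceeds `s` once `S` contains a further vertex. -/
def RootedBound (μ : Measure α) (K : α → α → ℝ≥0∞) (G : SimpleGraph ι) (r : ι) (s : ℝ)
    (S : Finset ι) : Prop :=
  ∃ a : ι → ℝ, (∀ i ∈ S, 0 < a i ∧ (S ≠ {r} → a i < 1)) ∧ (∀ i ∈ S, a i ≤ 1) ∧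
    s ≤ ∑ i ∈ S, a i ∧ (S ≠ {r} → s < ∑ i ∈ S, a i) ∧
    ∃ C : ℝ≥0, 0 < C ∧ ∀ f : ι → α → ℝ≥0∞, (∀ i, Measurable (f i)) → ∀ z : ι → α,
      lpInvNorm μ s (fun t => rootedIntegral μ K G r S f (Function.update z r t)) ≤
        C * ∏ i ∈ S, lpInvNorm μ (a i) (f i)

variable {μ : Measure α} {K : α → α → ℝ≥0∞} {G : SimpleGraph ι} {r : ι}

theorem rootedBound_singleton {s : ℝ} (hs : 0 < s) (hs1 : s ≤ 1) :
    RootedBound μ K G r s {r} := by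
  refine ⟨fun _ => s, by simp [hs], by simp [hs1], by simp, by simp, 1, one_pos, fun f _ z => ?_⟩
  have h : ∀ x : ι → α, subgraphProd K G {r} x = 1 := fun x => by
    unfold subgraphProd
    refine Finset.prod_eq_one fun e he => ?_
    simp only [Finset.mem_filter, Finset.mem_singleton] at he
    exact absurd he.2.1 (by rw [he.2.2.2.1, he.2.2.2.2]; exact lt_irrefl r)
  simp [rootedIntegral, h]

variable [SigmaFinite μ]

theorem rootedIntegral_insert (hK : Measurable fun p : α × α => K p.1 p.2) {S : Finset ι} {m l : ι}
    (hr : r ∈ S) (hm : m ∈ S) (hl : l ∉ S) (hml : G.Adj m l)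
    (huniq : ∀ j ∈ S, G.Adj j l → j = m) {f : ι → α → ℝ≥0∞} (hf : ∀ i, Measurable (f i)) :
    rootedIntegral μ K G r (insert l S) f = rootedIntegral μ K G r S
      (Function.update f m fun u => f m u * ∫⁻ v, orientedKernel K m l u v * f l v ∂μ) := by
  have hrl : l ≠ r := fun h => hl (h ▸ hr)
  have hmeas : Measurable fun x : ι → α =>
      subgraphProd K G (insert l S) x * ∏ i ∈ insert l S, f i (x i) :=
    (measurable_subgraphProd hK G _).mul
      (Finset.measurable_fun_prod _ fun i _ => (hf i).comp (measurable_pi_apply i))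
  unfold rootedIntegral
  rw [Finset.erase_insert_of_ne hrl, lmarginal_insert' _ hmeas (by simp [hl])]
  congr 1
  ext x
  have hx : ∀ i ∈ S, ∀ v, Function.update x l v i = x i := fun i hi v =>
    Function.update_of_ne (ne_of_mem_of_not_mem hi hl) _ _
  have hsub : ∀ v, subgraphProd K G S (Function.update x l v) = subgraphProd K G S x := fun v => by
    unfold subgraphProd
    refine Finset.prod_congr rfl fun e he => ?_
    simp only [Finset.mem_filter] at he
    rw [hx _ he.2.2.2.1, hx _ he.2.2.2.2]
  have hprod : ∀ v, ∏ i ∈ S, f i (Function.update x l v i) = ∏ i ∈ S, f i (x i) := fun v =>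
    Finset.prod_congr rfl fun i hi => by rw [hx i hi]
  have hker : Measurable fun v => orientedKernel K m l (x m) v * f l v :=
    ((measurable_orientedKernel hK m l).comp measurable_prodMk_left).mul (hf l)
  simp only [subgraphProd_insert K hm hl hml huniq, Finset.prod_insert hl, hsub, hprod, hx m hm,
    Function.update_self]
  calc ∫⁻ v, subgraphProd K G S x * orientedKernel K m l (x m) v *
          (f l v * ∏ i ∈ S, f i (x i)) ∂μ
      = ∫⁻ v, (subgraphProd K G S x * ∏ i ∈ S, f i (x i)) *
          (orientedKernel K m l (x m) v * f l v) ∂μ := lintegral_congr fun v => by ring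
    _ = (subgraphProd K G S x * ∏ i ∈ S, f i (x i)) *
          ∫⁻ v, orientedKernel K m l (x m) v * f l v ∂μ := lintegral_const_mul _ hker
    _ = _ := by
      rw [← Finset.mul_prod_erase S _ hm, ← Finset.mul_prod_erase S _ hm, Function.update_self]
      have : ∀ i ∈ S.erase m, Function.update f m
          (fun u => f m u * ∫⁻ v, orientedKernel K m l u v * f l v ∂μ) i (x i) = f i (x i) :=
        fun i hi => by rw [Function.update_of_ne (Finset.ne_of_mem_erase hi)]
      rw [Finset.prod_congr rfl this]
      ring

theorem RootedBound.insert_vertex (hK : Measurable fun p : α × α => K p.1 p.2) {s : ℝ}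
    (hker : ∀ m l : ι, ∀ ε > 0, ∃ b c, 0 < b ∧ b < ε ∧ b < c ∧ c < 1 ∧
      KernelBound μ (orientedKernel K m l) b c) {S : Finset ι} {m l : ι}
    (hr : r ∈ S) (hm : m ∈ S) (hl : l ∉ S) (hml : G.Adj m l)
    (huniq : ∀ j ∈ S, G.Adj j l → j = m) (h : RootedBound μ K G r s S) :
    RootedBound μ K G r s (insert l S) := by
  obtain ⟨a, ha, ha1, hsum, -, C, hC, H⟩ := h
  obtain ⟨b, c, hb, hbm, hbc, hc1, D, hD, HD⟩ := hker m l (a m) (ha m hm).1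
  have hlm : l ≠ m := hml.ne'
  let a' : ι → ℝ := Function.update (Function.update a m (a m - b)) l c
  have hal : a' l = c := by simp [a']
  have ham : a' m = a m - b := by simp [a', hlm.symm]
  have hai : ∀ i ∈ S.erase m, a' i = a i := fun i hi => by
    have h1 : i ≠ m := Finset.ne_of_mem_erase hi
    have h2 : i ≠ l := fun h => hl (h ▸ Finset.mem_of_mem_erase hi)
    simp [a', h1, h2]
  have hbound : ∀ i ∈ insert l S, 0 < a' i ∧ a' i < 1 := fun i hi => by
    rcases Finset.mem_insert.1 hi with rfl | hi
    · rw [hal]; exact ⟨hb.trans hbc, hc1⟩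
    by_cases him : i = m
    · subst him
      rw [ham]
      exact ⟨by linarith, by linarith [ha1 i hm]⟩
    · rw [hai i (Finset.mem_erase.2 ⟨him, hi⟩)]
      refine ⟨(ha i hi).1, (ha i hi).2 ?_⟩
      rintro rfl
      exact him ((Finset.mem_singleton.1 hi).trans (Finset.mem_singleton.1 hm).symm)
  have hsum' : s < ∑ i ∈ insert l S, a' i := by
    rw [Finset.sum_insert hl, hal, ← Finset.add_sum_erase S _ hm, ham,
      Finset.sum_congr rfl hai]
    rw [← Finset.add_sum_erase S _ hm] at hsum
    linarith
  refine ⟨a', fun i hi => ⟨(hbound i hi).1, fun _ => (hbound i hi).2⟩,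
    fun i hi => (hbound i hi).2.le, hsum'.le, fun _ => hsum', C * D, mul_pos hC hD,
    fun f hf z => ?_⟩
  have hT : Measurable fun u => ∫⁻ v, orientedKernel K m l u v * f l v ∂μ :=
    ((measurable_orientedKernel hK m l).mul ((hf l).comp measurable_snd)).lintegral_prod_right'
  set g : α → ℝ≥0∞ := fun u => f m u * ∫⁻ v, orientedKernel K m l u v * f l v ∂μ
  have hg_meas : Measurable g := (hf m).mul hT
  have hg_le : lpInvNorm μ (a m) g ≤
      lpInvNorm μ (a' m) (f m) * (D * lpInvNorm μ c (f l)) := by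
    have h1 := lpInvNorm_mul_le (μ := μ) (sub_pos.2 hbm) hb (hf m) hT
    rw [sub_add_cancel] at h1
    rw [ham]
    refine h1.trans ?_
    gcongr
    exact HD (f l) (hf l)
  have hupd : ∀ i, Measurable (Function.update f m g i) := fun i => by
    by_cases him : i = m
    · subst him; simpa using hg_meas
    · simpa [him] using hf i
  have hrest : ∏ i ∈ S.erase m, lpInvNorm μ (a i) (Function.update f m g i) =
      ∏ i ∈ S.erase m, lpInvNorm μ (a' i) (f i) :=
    Finset.prod_congr rfl fun i hi => by
      rw [hai i hi, Function.update_of_ne (Finset.ne_of_mem_erase hi)]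
  rw [rootedIntegral_insert hK hr hm hl hml huniq hf]
  refine (H _ hupd z).trans ?_
  rw [Finset.prod_insert hl, hal, ← Finset.mul_prod_erase S _ hm, ← Finset.mul_prod_erase S _ hm,
    hrest, Function.update_self]
  calc (C : ℝ≥0∞) * (lpInvNorm μ (a m) g * ∏ i ∈ S.erase m, lpInvNorm μ (a' i) (f i))
      ≤ C * ((lpInvNorm μ (a' m) (f m) * (D * lpInvNorm μ c (f l))) *
          ∏ i ∈ S.erase m, lpInvNorm μ (a' i) (f i)) := by gcongr
    _ = _ := by push_cast; ring

theorem rootedBound_univ (hK : Measurable fun p : α × α => K p.1 p.2) {s : ℝ} (hs : 0 < s)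
    (hs1 : s ≤ 1)
    (hker : ∀ m l : ι, ∀ ε > 0, ∃ b c, 0 < b ∧ b < ε ∧ b < c ∧ c < 1 ∧
      KernelBound μ (orientedKernel K m l) b c) (hG : G.IsTree) :
    RootedBound μ K G r s Finset.univ := by
  suffices h : ∀ n < Fintype.card ι, ∃ S : Finset ι, S.card = n + 1 ∧ r ∈ S ∧
      (G.induce (S : Set ι)).Preconnected ∧ RootedBound μ K G r s S by
    have hpos : 0 < Fintype.card ι := Fintype.card_pos_iff.2 ⟨r⟩
    obtain ⟨S, hS, -, -, hb⟩ := h (Fintype.card ι - 1) (by omega)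
    rwa [(Finset.card_eq_iff_eq_univ S).1 (by omega)] at hb
  intro n
  induction n with
  | zero =>
    intro _
    refine ⟨{r}, by simp, by simp, ?_, rootedBound_singleton hs hs1⟩
    rw [Finset.coe_singleton]
    exact SimpleGraph.Preconnected.of_subsingleton
  | succ n ih =>
    intro hn
    obtain ⟨S, hcard, hr, hconn, hb⟩ := ih (by omega)
    obtain ⟨v, hv⟩ : ∃ v, v ∉ S := by
      by_contra! hall
      rw [Finset.eq_univ_iff_forall.2 hall, Finset.card_univ] at hcard
      omega
    obtain ⟨m, hm, l, hl, hml, huniq, hconn'⟩ := exists_adjacent_extension hG ⟨r, hr⟩ hv hconn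
    exact ⟨insert l S, by rw [Finset.card_insert_of_notMem hl, hcard],
      Finset.mem_insert_of_mem hr, hconn', hb.insert_vertex hK hker hr hm hl hml huniq⟩

end RootedIntegral

theorem UnivImp.exists_kernelBound_orientedKernel {ι : Type*} [LinearOrder ι] {d : ℕ}
    {K : EuclideanSpace ℝ (Fin d) → EuclideanSpace ℝ (Fin d) → ℝ≥0} (hTK : UnivImp K)
    (hK : Measurable fun p : EuclideanSpace ℝ (Fin d) × EuclideanSpace ℝ (Fin d) => K p.1 p.2)
    (m l : ι) {ε : ℝ} (hε : 0 < ε) :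
    ∃ b c, 0 < b ∧ b < ε ∧ b < c ∧ c < 1 ∧
      KernelBound volume (orientedKernel (fun x y => (K x y : ℝ≥0∞)) m l) b c := by
  by_cases hml : m < l
  · have hb : 0 < min (ε / 2) (1 / 2) := by positivity
    obtain ⟨c, hbc, hc1, h⟩ := hTK.exists_kernelBound hb
      ((min_le_right _ _).trans_lt (by norm_num))
    refine ⟨_, c, hb, (min_le_left _ _).trans_lt (by linarith), hbc, hc1, ?_⟩
    simpa [orientedKernel, hml, KernelBound] using h
  · have hb : 0 < max (1 - ε / 2) (1 / 2) := lt_max_of_lt_right (by norm_num)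
    have hb1 : max (1 - ε / 2) (1 / 2) < 1 := max_lt (by linarith) (by norm_num)
    obtain ⟨c, hbc, hc1, h⟩ := hTK.exists_kernelBound hb hb1
    have hle := le_max_left (1 - ε / 2) (1 / 2)
    refine ⟨1 - c, 1 - max (1 - ε / 2) (1 / 2), by linarith, by linarith, by linarith,
      by linarith, ?_⟩
    have h' := h.transpose hK.coe_nnreal_ennreal hb hb1 (hb.trans hbc) hc1
    simpa [orientedKernel, hml, KernelBound] using h'

theorem edgeProd_eq_subgraphProd {d n : ℕ}
    (K : EuclideanSpace ℝ (Fin d) → EuclideanSpace ℝ (Fin d) → ℝ≥0)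
    (G : SimpleGraph (Fin n)) (x : Fin n → EuclideanSpace ℝ (Fin d)) :
    edgeProd K G x = subgraphProd (fun u v => (K u v : ℝ≥0∞)) G Finset.univ x := by
  simp only [edgeProd, subgraphProd, Finset.prod_filter, Fintype.prod_prod_type]
  exact Finset.prod_congr rfl fun i _ => Finset.prod_congr rfl fun j _ => by
    congr 1
    simp

theorem mul_Ufun_eq_rootedIntegral {d n : ℕ}
    (K : EuclideanSpace ℝ (Fin d) → EuclideanSpace ℝ (Fin d) → ℝ≥0)
    (G : SimpleGraph (Fin n)) (r : Fin n) (f : Fin n → EuclideanSpace ℝ (Fin d) → ℝ≥0)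
    (x : EuclideanSpace ℝ (Fin d)) (z : Fin n → EuclideanSpace ℝ (Fin d)) :
    (f r x : ℝ≥0∞) * Ufun K G r f x =
      rootedIntegral volume (fun u v => (K u v : ℝ≥0∞)) G r Finset.univ
        (fun i u => (f i u : ℝ≥0∞)) (Function.update z r x) := by
  let e : {i : Fin n // i ≠ r} ≃ (Finset.univ.erase r : Finset (Fin n)) :=
    Equiv.subtypeEquivRight fun i => by simp
  rw [Ufun, ← lintegral_const_mul' _ _ ENNReal.coe_ne_top, rootedIntegral, lmarginal,
    ← (measurePreserving_piCongrLeft (fun _ : (Finset.univ.erase r : Finset (Fin n)) =>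
      (volume : Measure (EuclideanSpace ℝ (Fin d)))) e).lintegral_comp_emb
      (MeasurableEquiv.measurableEmbedding _)]
  refine lintegral_congr fun y => ?_
  have hext : Function.updateFinset (Function.update z r x) (Finset.univ.erase r)
      (MeasurableEquiv.piCongrLeft (fun _ => EuclideanSpace ℝ (Fin d)) e y) =
      extendAt r x y := by
    ext1 i
    by_cases hi : i = r
    · subst hi
      simp [Function.updateFinset, extendAt]
    · have hmem : i ∈ Finset.univ.erase r := by simp [hi]
      have := Equiv.piCongrLeft_apply_apply (fun _ => EuclideanSpace ℝ (Fin d)) e y ⟨i, hi⟩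
      simp only [Function.updateFinset, hmem, extendAt, hi, dif_pos, dif_neg, not_false_eq_true]
      exact this
  rw [hext, ← edgeProd_eq_subgraphProd, ← Finset.mul_prod_erase _ _ (Finset.mem_univ r)]
  have h1 : ∏ i : {i : Fin n // i ≠ r}, (f i (y i) : ℝ≥0∞) =
      ∏ i ∈ Finset.univ.erase r, (f i (extendAt r x y i) : ℝ≥0∞) := by
    rw [Finset.prod_subtype (Finset.univ.erase r) (p := fun i => i ≠ r) (fun i => by simp)]
    exact Finset.prod_congr rfl fun i _ => by simp [extendAt, i.2]
  have h2 : extendAt r x y r = x := by simp [extendAt]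
  rw [h1, h2]
  ring

theorem lpNormE_eq_lpInvNorm {d : ℕ} {q : ℝ≥0∞} (hq : q ≠ ∞)
    (g : EuclideanSpace ℝ (Fin d) → ℝ≥0∞) :
    lpNormE q g = lpInvNorm volume (1 / q.toReal) g := by
  simp [lpNormE, lpInvNorm, hq]

theorem nnLpNorm'_eq_lpInvNorm {d : ℕ} {a : ℝ} (ha : 0 < a)
    (f : EuclideanSpace ℝ (Fin d) → ℝ≥0) :
    nnLpNorm' (ENNReal.ofReal (1 / a)) f = lpInvNorm volume a (fun x => (f x : ℝ≥0∞)) := by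
  rw [nnLpNorm', eLpNorm_eq_lintegral_rpow_enorm_toReal (by simpa using ha) ENNReal.ofReal_ne_top,
    lpInvNorm, ENNReal.toReal_ofReal (by positivity), one_div_one_div]
  simp

/-- If `T_K` is universally `L^p`-improving and `G` is a tree on `{1,…,n}` rooted at the
vertex `1`, then for every `q ∈ [1,∞)` there are exponents `pᵢ ∈ (1,∞)` with
`∑ 1/pᵢ > 1/q` and `C > 0` such that `‖f₁ · U‖_{L^q} ≤ C ∏ ‖fᵢ‖_{L^{pᵢ}}` for all
nonnegative measurable `f₁,…,fₙ`. -/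
theorem tree_root_weighted_estimate (d n : ℕ) (hd : 1 ≤ d) (hn : 2 ≤ n)
    (K : EuclideanSpace ℝ (Fin d) → EuclideanSpace ℝ (Fin d) → ℝ≥0)
    (hK : Measurable fun p : EuclideanSpace ℝ (Fin d) × EuclideanSpace ℝ (Fin d) => K p.1 p.2)
    (hTK : UnivImp K)
    (G : SimpleGraph (Fin n)) (hG : G.IsTree) :
    ∀ q : ℝ≥0∞, 1 ≤ q → q < ∞ →
      ∃ (p : Fin n → ℝ≥0∞) (C : ℝ), 0 < C ∧ (∀ i, 1 < p i ∧ p i < ∞) ∧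
        q⁻¹ < ∑ i, (p i)⁻¹ ∧
        ∀ f : Fin n → EuclideanSpace ℝ (Fin d) → ℝ≥0, (∀ i, Measurable (f i)) →
          lpNormE q
              (fun x => (f ⟨0, by omega⟩ x : ℝ≥0∞) * Ufun K G ⟨0, by omega⟩ f x) ≤
            ENNReal.ofReal C * ∏ i, nnLpNorm' (p i) (f i) := by
  intro q hq hq_top
  have hq1 : 1 ≤ q.toReal := by
    simpa using (ENNReal.toReal_le_toReal ENNReal.one_ne_top hq_top.ne).2 hq
  have hq0 : 0 < 1 / q.toReal := by positivity
  obtain ⟨a, ha, -, -, hsum, C, hC, H⟩ := rootedBound_univ (r := (⟨0, by omega⟩ : Fin n))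
    (μ := (volume : Measure (EuclideanSpace ℝ (Fin d)))) hK.coe_nnreal_ennreal hq0
    ((div_le_one (by linarith)).2 hq1)
    (fun m l ε hε => hTK.exists_kernelBound_orientedKernel hK m l hε) hG
  have hne : (Finset.univ : Finset (Fin n)) ≠ {⟨0, by omega⟩} := fun h => by
    have := congrArg Finset.card h
    simp at this
    omega
  have ha0 : ∀ i, 0 < a i := fun i => (ha i (Finset.mem_univ i)).1
  have ha1 : ∀ i, a i < 1 := fun i => (ha i (Finset.mem_univ i)).2 hne
  refine ⟨fun i => ENNReal.ofReal (1 / a i), C, by exact_mod_cast hC, fun i => ⟨?_, ?_⟩, ?_, ?_⟩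
  · rw [ENNReal.one_lt_ofReal]
    exact (one_lt_div (ha0 i)).2 (ha1 i)
  · exact ENNReal.ofReal_lt_top
  · have h1 : ∀ i, (ENNReal.ofReal (1 / a i))⁻¹ = ENNReal.ofReal (a i) := fun i => by
      rw [← ENNReal.ofReal_inv_of_pos (one_div_pos.2 (ha0 i)), one_div, inv_inv]
    have h2 : q⁻¹ = ENNReal.ofReal (1 / q.toReal) := by
      rw [one_div, ENNReal.ofReal_inv_of_pos (by linarith), ENNReal.ofReal_toReal hq_top.ne]
    simp only [h1]
    rw [← ENNReal.ofReal_sum_of_nonneg fun i _ => (ha0 i).le, h2]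
    exact (ENNReal.ofReal_lt_ofReal_iff (hq0.trans (hsum hne))).2 (hsum hne)
  · intro f hf
    rw [lpNormE_eq_lpInvNorm hq_top.ne]
    simp only [mul_Ufun_eq_rootedIntegral K G _ f _ 0, nnLpNorm'_eq_lpInvNorm (ha0 _)]
    rw [ENNReal.ofReal_coe_nnreal]
    exact H _ (fun i => (hf i).coe_nnreal_ennreal) 0
end
end

section
/- Let d ≥ 1, n₁, n₂ ≥ 2, and let K : ℝ^d × ℝ^d → [0,∞) be measurable. Let G₁ be a connected simple graph on the vertex set {1,…,n₁} and G₂ a connected simple graph on the vertex set {n₁, n₁+1,…,n₁+n₂−1}, so that G₁ and G₂ share exactly the vertex n₁. Let G be the graph on {1,…,n₁+n₂−1} whose edge set is the union of the edge sets of G₁ and G₂. Suppose the form Λ_{G₂}^K (in the variables indexed by the vertices of G₂) is universally L^p-improving, and the form Λ_{G₁}^K has a non-trivial estimate at the common vertex n₁. Then Λ_G^K is L^p-improving. -/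
open MeasureTheory ENNReal NNReal

noncomputable section

open Classical in
/-- The product of `K(x^i, x^j)` over the edges `{i,j} ∈ E(G)`, `i < j`, for a graph on a
finite linearly ordered vertex type. -/
def edgeProdV {d : ℕ} {V : Type*} [Fintype V] [LinearOrder V]
    (K : EuclideanSpace ℝ (Fin d) → EuclideanSpace ℝ (Fin d) → ℝ≥0)
    (G : SimpleGraph V) (x : V → EuclideanSpace ℝ (Fin d)) : ℝ≥0∞ :=
  ∏ i, ∏ j, if i < j ∧ G.Adj i j then (K (x i) (x j) : ℝ≥0∞) else 1

/-- The multilinear form `Λ_G^K`. -/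
def lamFormV {d : ℕ} {V : Type*} [Fintype V] [LinearOrder V]
    (K : EuclideanSpace ℝ (Fin d) → EuclideanSpace ℝ (Fin d) → ℝ≥0)
    (G : SimpleGraph V) (f : V → EuclideanSpace ℝ (Fin d) → ℝ≥0) : ℝ≥0∞ :=
  ∫⁻ x : V → EuclideanSpace ℝ (Fin d), edgeProdV K G x * ∏ i, (f i (x i) : ℝ≥0∞)

/-- `Λ_G^K` is `L^p`-improving. -/
def LpImprovingForm {d : ℕ} {V : Type*} [Fintype V] [LinearOrder V]
    (K : EuclideanSpace ℝ (Fin d) → EuclideanSpace ℝ (Fin d) → ℝ≥0)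
    (G : SimpleGraph V) : Prop :=
  ∃ (p : V → ℝ≥0∞) (C : ℝ), 0 < C ∧ (∀ i, 1 ≤ p i) ∧ 1 < ∑ i, (p i)⁻¹ ∧
    ∀ f : V → EuclideanSpace ℝ (Fin d) → ℝ≥0, (∀ i, Measurable (f i)) →
      lamFormV K G f ≤ ENNReal.ofReal C * ∏ i, nnLpNorm' (p i) (f i)

/-- `Λ_G^K` has a non-trivial estimate at the vertex `i0`: there are exponents
`pᵥ ∈ [1,∞]` with `p_{i0} < ∞` and `∑ 1/pᵥ ≥ 1`, and a constant `C > 0`, bounding the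
form by `C ∏ ‖fᵥ‖_{L^{pᵥ}}`. -/
def NontrivialAt {d : ℕ} {V : Type*} [Fintype V] [LinearOrder V]
    (K : EuclideanSpace ℝ (Fin d) → EuclideanSpace ℝ (Fin d) → ℝ≥0)
    (G : SimpleGraph V) (i0 : V) : Prop :=
  ∃ (p : V → ℝ≥0∞) (C : ℝ), 0 < C ∧ (∀ i, 1 ≤ p i) ∧ p i0 < ∞ ∧ 1 ≤ ∑ i, (p i)⁻¹ ∧
    ∀ f : V → EuclideanSpace ℝ (Fin d) → ℝ≥0, (∀ i, Measurable (f i)) →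
      lamFormV K G f ≤ ENNReal.ofReal C * ∏ i, nnLpNorm' (p i) (f i)

/-- The family of variables obtained by substituting `x` for the coordinate `i0`. -/
def extendAtV {d : ℕ} {V : Type*} [DecidableEq V] (i0 : V) (x : EuclideanSpace ℝ (Fin d))
    (z : {v : V // v ≠ i0} → EuclideanSpace ℝ (Fin d)) (v : V) : EuclideanSpace ℝ (Fin d) :=
  if h : v = i0 then x else z ⟨v, h⟩

open Classical in
/-- The `(n-1)`-linear operator `T_{i0}` obtained from `Λ_G^K` by integrating out all
variables except `x^{i0}`. -/
def Tvertex {d : ℕ} {V : Type*} [Fintype V] [LinearOrder V]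
    (K : EuclideanSpace ℝ (Fin d) → EuclideanSpace ℝ (Fin d) → ℝ≥0)
    (G : SimpleGraph V) (i0 : V) (f : V → EuclideanSpace ℝ (Fin d) → ℝ≥0)
    (x : EuclideanSpace ℝ (Fin d)) : ℝ≥0∞ :=
  ∫⁻ z : {v : V // v ≠ i0} → EuclideanSpace ℝ (Fin d),
    edgeProdV K G (extendAtV i0 x z) * ∏ v : {v : V // v ≠ i0}, ((f v (z v) : ℝ≥0∞))

/-- The form `Λ_G^K` is universally `L^p`-improving: for every vertex `i0` and every
`r ∈ (1,∞)` there are exponents `pᵥ ∈ [1,∞]` (`v ≠ i0`) with `∑_{v ≠ i0} 1/pᵥ > 1/r` and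
a constant `C > 0` with `‖T_{i0}(fᵥ)‖_{L^r} ≤ C ∏_{v ≠ i0} ‖fᵥ‖_{L^{pᵥ}}`. -/
def FormUnivImproving {d : ℕ} {V : Type*} [Fintype V] [LinearOrder V]
    (K : EuclideanSpace ℝ (Fin d) → EuclideanSpace ℝ (Fin d) → ℝ≥0)
    (G : SimpleGraph V) : Prop :=
  ∀ (i0 : V) (r : ℝ≥0∞), 1 < r → r < ∞ →
    ∃ (p : {v : V // v ≠ i0} → ℝ≥0∞) (C : ℝ), 0 < C ∧ (∀ v, 1 ≤ p v) ∧
      r⁻¹ < ∑ v, (p v)⁻¹ ∧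
      ∀ f : V → EuclideanSpace ℝ (Fin d) → ℝ≥0, (∀ v, Measurable (f v)) →
        lpNormE r (Tvertex K G i0 f) ≤
          ENNReal.ofReal C * ∏ v : {v : V // v ≠ i0}, nnLpNorm' (p v) (f v)

section Joining

variable {d : ℕ} {V : Type*} [Fintype V] [LinearOrder V]
  {K : EuclideanSpace ℝ (Fin d) → EuclideanSpace ℝ (Fin d) → ℝ≥0}

theorem measurable_edgeProdV
    (hK : Measurable fun p : EuclideanSpace ℝ (Fin d) × EuclideanSpace ℝ (Fin d) => K p.1 p.2)
    (G : SimpleGraph V) : Measurable (edgeProdV K G) := by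
  classical
  unfold edgeProdV
  refine Finset.measurable_fun_prod _ fun i _ => Finset.measurable_fun_prod _ fun j _ => ?_
  split_ifs
  · exact (hK.comp (f := fun x : V → EuclideanSpace ℝ (Fin d) => (x i, x j))
      ((measurable_pi_apply i).prodMk (measurable_pi_apply j))).coe_nnreal_ennreal
  · exact measurable_const

theorem measurable_edgeProdV_mul_prod
    (hK : Measurable fun p : EuclideanSpace ℝ (Fin d) × EuclideanSpace ℝ (Fin d) => K p.1 p.2)
    (G : SimpleGraph V) {f : V → EuclideanSpace ℝ (Fin d) → ℝ≥0} (hf : ∀ v, Measurable (f v)) :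
    Measurable fun x : V → EuclideanSpace ℝ (Fin d) =>
      edgeProdV K G x * ∏ i, (f i (x i) : ℝ≥0∞) :=
  (measurable_edgeProdV hK G).mul (Finset.measurable_fun_prod _ fun v _ =>
    ((hf v).comp (measurable_pi_apply v)).coe_nnreal_ennreal)

theorem measurable_extendAtV {V : Type*} [DecidableEq V] (i0 : V) :
    Measurable fun p : EuclideanSpace ℝ (Fin d) × ({v : V // v ≠ i0} → EuclideanSpace ℝ (Fin d)) =>
      extendAtV i0 p.1 p.2 := by
  refine measurable_pi_iff.mpr fun v => ?_
  unfold extendAtV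
  split_ifs
  · exact measurable_fst
  · exact (measurable_pi_apply _).comp measurable_snd

theorem measurable_Tvertex
    (hK : Measurable fun p : EuclideanSpace ℝ (Fin d) × EuclideanSpace ℝ (Fin d) => K p.1 p.2)
    (G : SimpleGraph V) (i0 : V) {f : V → EuclideanSpace ℝ (Fin d) → ℝ≥0}
    (hf : ∀ v, Measurable (f v)) : Measurable (Tvertex K G i0 f) := by
  classical
  refine Measurable.lintegral_prod_right' (f := fun p : EuclideanSpace ℝ (Fin d) ×
    ({v : V // v ≠ i0} → EuclideanSpace ℝ (Fin d)) => edgeProdV K G (extendAtV i0 p.1 p.2) *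
      ∏ v : {v : V // v ≠ i0}, ((f v (p.2 v) : ℝ≥0∞))) ?_
  refine ((measurable_edgeProdV hK G).comp (measurable_extendAtV i0)).mul
    (Finset.measurable_fun_prod _ fun v _ => ?_)
  exact ((hf v).comp ((measurable_pi_apply v).comp measurable_snd)).coe_nnreal_ennreal

/-- The edge product only sees a vertex set supporting all edges. -/
theorem edgeProdV_induce (G : SimpleGraph V) (A : Set V) [Fintype A]
    (hG : ∀ i j, G.Adj i j → i ∈ A ∧ j ∈ A) (x : V → EuclideanSpace ℝ (Fin d)) :
    edgeProdV K (G.induce A) (fun a => x a) = edgeProdV K G x := by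
  classical
  have key : ∀ h : V → ℝ≥0∞, (∀ v, v ∉ A → h v = 1) → ∏ v, h v = ∏ a : A, h a := by
    intro h hh
    rw [← Finset.prod_subtype A.toFinset (by simp) h]
    exact (Finset.prod_subset (Finset.subset_univ _) fun v _ hv => hh v (by simpa using hv)).symm
  unfold edgeProdV
  rw [key]
  · refine Finset.prod_congr rfl fun i _ => ?_
    rw [key]
    · refine Finset.prod_congr rfl fun j _ => ?_
      simp [SimpleGraph.comap_adj]
    · intro j hj
      exact if_neg fun h => hj (hG _ _ h.2).2
  · intro i hi
    exact Finset.prod_eq_one fun j _ => if_neg fun h => hi (hG _ _ h.2).1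

theorem edgeProdV_sup {G₁ G₂ : SimpleGraph V} (h : ∀ i j, G₁.Adj i j → ¬ G₂.Adj i j)
    (x : V → EuclideanSpace ℝ (Fin d)) :
    edgeProdV K (G₁ ⊔ G₂) x = edgeProdV K G₁ x * edgeProdV K G₂ x := by
  classical
  unfold edgeProdV
  simp_rw [← Finset.prod_mul_distrib]
  refine Finset.prod_congr rfl fun i _ => Finset.prod_congr rfl fun j _ => ?_
  have := h i j
  by_cases h1 : G₁.Adj i j <;> by_cases h2 : G₂.Adj i j <;> simp_all

/-- If `A ∪ B` is everything and `A ∩ B = {i0}`, the vertices are those of `A` together with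
those of `B` other than `i0`. -/
def joinEquiv {V : Type*} {A B : Set V} {i0 : V} (hA : i0 ∈ A) (hB : i0 ∈ B)
    (hAB : ∀ v, v ∈ A ∨ v ∈ B) (hi0 : ∀ v, v ∈ A → v ∈ B → v = i0) :
    A ⊕ {b : B // b ≠ ⟨i0, hB⟩} ≃ V :=
  Equiv.ofBijective (Sum.elim (fun a => a.1) fun b => b.1.1) <| by
    constructor
    · rintro (⟨a, ha⟩ | ⟨⟨b, hb⟩, hne⟩) (⟨a', ha'⟩ | ⟨⟨b', hb'⟩, hne'⟩) h <;>
        simp only [Sum.elim_inl, Sum.elim_inr] at h <;> subst h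
      · rfl
      · exact absurd (Subtype.ext (hi0 _ ha hb')) hne'
      · exact absurd (Subtype.ext (hi0 _ ha' hb)) hne
      · rfl
    · intro v
      by_cases hv : v ∈ A
      · exact ⟨.inl ⟨v, hv⟩, rfl⟩
      · exact ⟨.inr ⟨⟨v, (hAB v).resolve_left hv⟩,
          fun h => hv (by rw [show v = i0 from congrArg Subtype.val h]; exact hA)⟩, rfl⟩

theorem lintegral_pi_sum_equiv {ι κ V : Type*} [Fintype ι] [Fintype κ] [Fintype V] (e : ι ⊕ κ ≃ V)
    {F : (V → EuclideanSpace ℝ (Fin d)) → ℝ≥0∞} (hF : Measurable F) :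
    ∫⁻ x, F x = ∫⁻ y : ι → EuclideanSpace ℝ (Fin d), ∫⁻ z : κ → EuclideanSpace ℝ (Fin d),
      F fun v => Sum.elim y z (e.symm v) := by
  have h1 := volume_measurePreserving_piCongrLeft (fun _ : V => EuclideanSpace ℝ (Fin d)) e
  have h2 := (volume_measurePreserving_sumPiEquivProdPi
    (fun _ : ι ⊕ κ => EuclideanSpace ℝ (Fin d))).symm
  have h3 := h1.comp h2
  rw [← h3.lintegral_comp hF, Measure.volume_eq_prod,
    lintegral_prod (fun w => F _) (hF.comp h3.measurable).aemeasurable]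
  refine lintegral_congr fun y => lintegral_congr fun z => congrArg F ?_
  funext v
  rw [Function.comp_apply]
  obtain ⟨s, rfl⟩ := e.surjective v
  rw [MeasurableEquiv.coe_piCongrLeft, Equiv.piCongrLeft_apply_apply, Equiv.symm_apply_apply]
  rcases s with s | s <;> rfl

/-- Integrating out the vertices of `G₂` other than the common one. -/
theorem lamFormV_sup
    (hK : Measurable fun p : EuclideanSpace ℝ (Fin d) × EuclideanSpace ℝ (Fin d) => K p.1 p.2)
    {G₁ G₂ : SimpleGraph V} {A B : Set V} [Fintype A] [Fintype B] {i0 : V}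
    (hA : i0 ∈ A) (hB : i0 ∈ B) (hAB : ∀ v, v ∈ A ∨ v ∈ B)
    (hi0 : ∀ v, v ∈ A → v ∈ B → v = i0)
    (hG₁ : ∀ i j, G₁.Adj i j → i ∈ A ∧ j ∈ A) (hG₂ : ∀ i j, G₂.Adj i j → i ∈ B ∧ j ∈ B)
    {f : V → EuclideanSpace ℝ (Fin d) → ℝ≥0} (hf : ∀ v, Measurable (f v)) :
    lamFormV K (G₁ ⊔ G₂) f = ∫⁻ y : A → EuclideanSpace ℝ (Fin d),
      edgeProdV K (G₁.induce A) y * (∏ a : A, (f a (y a) : ℝ≥0∞)) *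
        Tvertex K (G₂.induce B) ⟨i0, hB⟩ (fun b => f b) (y ⟨i0, hA⟩) := by
  classical
  unfold lamFormV
  have hdisj : ∀ i j, G₁.Adj i j → ¬ G₂.Adj i j := fun i j h1 h2 =>
    h1.ne ((hi0 i (hG₁ _ _ h1).1 (hG₂ _ _ h2).1).trans (hi0 j (hG₁ _ _ h1).2 (hG₂ _ _ h2).2).symm)
  rw [lintegral_pi_sum_equiv (joinEquiv hA hB hAB hi0) (measurable_edgeProdV_mul_prod hK _ hf)]
  refine lintegral_congr fun y => ?_
  unfold Tvertex
  have hm : Measurable fun z : {b : B // b ≠ ⟨i0, hB⟩} → EuclideanSpace ℝ (Fin d) =>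
      edgeProdV K (G₂.induce B) (extendAtV ⟨i0, hB⟩ (y ⟨i0, hA⟩) z) *
        ∏ v : {b : B // b ≠ ⟨i0, hB⟩}, (f v.1.1 (z v) : ℝ≥0∞) := by
    refine (((measurable_edgeProdV hK _).comp (measurable_extendAtV _)).comp
      measurable_prodMk_left).mul (Finset.measurable_fun_prod _ fun v _ => ?_)
    exact ((hf _).comp (measurable_pi_apply v)).coe_nnreal_ennreal
  refine (lintegral_congr fun z => ?_).trans ((lintegral_const_mul _ hm).trans (by congr!))
  set x : V → EuclideanSpace ℝ (Fin d) :=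
    fun v => Sum.elim y z ((joinEquiv hA hB hAB hi0).symm v) with hx
  have hxA : ∀ a : A, x a = y a := fun a => by
    have : (joinEquiv hA hB hAB hi0) (.inl a) = a := rfl
    rw [hx, ← this]; simp
  have hxB : ∀ b : {b : B // b ≠ ⟨i0, hB⟩}, x b.1.1 = z b := fun b => by
    have : (joinEquiv hA hB hAB hi0) (.inr b) = b.1.1 := rfl
    rw [hx, ← this]; simp
  have hy : (fun a : A => x a) = y := funext hxA
  have hz : (fun b : B => x b) = extendAtV ⟨i0, hB⟩ (y ⟨i0, hA⟩) z := by
    funext b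
    unfold extendAtV
    split_ifs with h
    · rw [h, ← hxA]
    · exact hxB ⟨b, h⟩
  rw [edgeProdV_sup hdisj, ← edgeProdV_induce G₁ A hG₁, ← edgeProdV_induce G₂ B hG₂, hy, hz,
    ← (joinEquiv hA hB hAB hi0).prod_comp, Fintype.prod_sum_type]
  have e1 : ∀ a : A, f (joinEquiv hA hB hAB hi0 (.inl a)) (x (joinEquiv hA hB hAB hi0 (.inl a))) =
      f a (y a) := fun a => by rw [← hxA]; rfl
  have e2 : ∀ b : {b : B // b ≠ ⟨i0, hB⟩},
      f (joinEquiv hA hB hAB hi0 (.inr b)) (x (joinEquiv hA hB hAB hi0 (.inr b))) =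
      f b.1.1 (z b) := fun b => by rw [← hxB]; rfl
  simp_rw [e1, e2]
  ring

theorem nnLpNorm'_eq {q : ℝ≥0∞} (h0 : q ≠ 0) (ht : q ≠ ∞)
    (f : EuclideanSpace ℝ (Fin d) → ℝ≥0) :
    nnLpNorm' q f = (∫⁻ x, (f x : ℝ≥0∞) ^ q.toReal) ^ (1 / q.toReal) := by
  unfold nnLpNorm'
  rw [eLpNorm_eq_lintegral_rpow_enorm_toReal h0 ht]
  simp

/-- Hölder's inequality splitting `L^q` symmetrically into two factors in `L^{2q}`. -/
theorem nnLpNorm'_mul_le {q : ℝ≥0∞} (h1 : 1 ≤ q) (ht : q < ∞)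
    {f g : EuclideanSpace ℝ (Fin d) → ℝ≥0} (hf : Measurable f)
    {T : EuclideanSpace ℝ (Fin d) → ℝ≥0∞} (hT : Measurable T) (hg : ∀ x, (g x : ℝ≥0∞) ≤ T x) :
    nnLpNorm' q (fun x => f x * g x) ≤ nnLpNorm' (2 * q) f * lpNormE (2 * q) T := by
  have h0 : q ≠ 0 := (zero_lt_one.trans_le h1).ne'
  have h2t : 2 * q ≠ ∞ := ENNReal.mul_ne_top (by simp) ht.ne
  have hq : 0 < q.toReal := ENNReal.toReal_pos h0 ht.ne
  rw [nnLpNorm'_eq h0 ht.ne, nnLpNorm'_eq (by simp [h0]) h2t, lpNormE, if_neg h2t]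
  have hr : (2 * q).toReal = 2 * q.toReal := by simp
  rw [hr]
  refine le_trans ?_ (ENNReal.lintegral_Lp_mul_le_Lq_mul_Lr hq (q := 2 * q.toReal)
    (r := 2 * q.toReal) (by linarith) (by field_simp; norm_num) volume
    hf.coe_nnreal_ennreal.aemeasurable hT.aemeasurable)
  gcongr with x
  simp only [ENNReal.coe_mul, Pi.mul_apply]
  gcongr
  exact hg x

/-- An estimate for `Λ_G^K` also applies when the function at one vertex is multiplied by an
`ℝ≥0∞`-valued weight. -/
theorem lintegral_mul_le_of_lamFormV_le
    (hK : Measurable fun p : EuclideanSpace ℝ (Fin d) × EuclideanSpace ℝ (Fin d) => K p.1 p.2)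
    {G : SimpleGraph V} {i0 : V} {p : V → ℝ≥0∞} {C : ℝ≥0∞} (hp : 1 ≤ p i0) (hpt : p i0 < ∞)
    (hG : ∀ f : V → EuclideanSpace ℝ (Fin d) → ℝ≥0, (∀ i, Measurable (f i)) →
      lamFormV K G f ≤ C * ∏ i, nnLpNorm' (p i) (f i))
    {f : V → EuclideanSpace ℝ (Fin d) → ℝ≥0} (hf : ∀ i, Measurable (f i))
    {T : EuclideanSpace ℝ (Fin d) → ℝ≥0∞} (hT : Measurable T) :
    ∫⁻ y : V → EuclideanSpace ℝ (Fin d),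
        edgeProdV K G y * (∏ i, (f i (y i) : ℝ≥0∞)) * T (y i0) ≤
      C * ((∏ i, nnLpNorm' (Function.update p i0 (2 * p i0) i) (f i)) *
        lpNormE (2 * p i0) T) := by
  have hsup : ∀ y : V → EuclideanSpace ℝ (Fin d),
      edgeProdV K G y * (∏ i, (f i (y i) : ℝ≥0∞)) * T (y i0) =
      ⨆ k : ℕ, edgeProdV K G y * (∏ i, (f i (y i) : ℝ≥0∞)) * min (T (y i0)) k := fun y => by
    rw [← ENNReal.mul_iSup, ← inf_iSup_eq, ENNReal.iSup_natCast, inf_top_eq]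
  have hmeas : Measurable fun y : V → EuclideanSpace ℝ (Fin d) =>
      edgeProdV K G y * ∏ i, (f i (y i) : ℝ≥0∞) :=
    measurable_edgeProdV_mul_prod hK G hf
  simp_rw [hsup]
  have hmin : ∀ k : ℕ, Measurable fun y : V → EuclideanSpace ℝ (Fin d) =>
      edgeProdV K G y * (∏ i, (f i (y i) : ℝ≥0∞)) * min (T (y i0)) k := fun k =>
    hmeas.mul ((hT.comp (measurable_pi_apply i0)).min measurable_const)
  rw [lintegral_iSup hmin (fun k l hkl y => by dsimp only; gcongr)]
  refine iSup_le fun k => ?_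
  set g : EuclideanSpace ℝ (Fin d) → ℝ≥0 := fun x => (min (T x) k).toNNReal
  have hgc : ∀ x, (g x : ℝ≥0∞) = min (T x) k := fun x =>
    ENNReal.coe_toNNReal (ne_top_of_le_ne_top (ENNReal.natCast_ne_top k) (min_le_right _ _))
  have hgm : Measurable g := (hT.min measurable_const).ennreal_toNNReal
  have hu := hG (Function.update f i0 fun x => f i0 x * g x) (fun i => by
    by_cases h : i = i0
    · subst h; rw [Function.update_self]; exact (hf i).mul hgm
    · simpa [h] using hf i)
  have hl : lamFormV K G (Function.update f i0 fun x => f i0 x * g x) =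
      ∫⁻ y : V → EuclideanSpace ℝ (Fin d),
        edgeProdV K G y * (∏ i, (f i (y i) : ℝ≥0∞)) * min (T (y i0)) k := by
    unfold lamFormV
    refine lintegral_congr fun y => ?_
    rw [← hgc, mul_assoc]
    congr 1
    rw [← Finset.mul_prod_erase _ _ (Finset.mem_univ i0),
      ← Finset.mul_prod_erase Finset.univ (fun i => (f i (y i) : ℝ≥0∞)) (Finset.mem_univ i0),
      Finset.prod_congr rfl (g := fun i => (f i (y i) : ℝ≥0∞))
        fun i hi => by rw [Function.update_of_ne (Finset.ne_of_mem_erase hi)]]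
    simp only [Function.update_self, ENNReal.coe_mul]
    ring
  rw [← hl]
  refine hu.trans ?_
  gcongr
  rw [← Finset.mul_prod_erase _ _ (Finset.mem_univ i0),
    ← Finset.mul_prod_erase Finset.univ
      (fun i => nnLpNorm' (Function.update p i0 (2 * p i0) i) (f i)) (Finset.mem_univ i0),
    Finset.prod_congr rfl (g := fun i => nnLpNorm' (Function.update p i0 (2 * p i0) i) (f i))
      fun i hi => by
        rw [Function.update_of_ne (Finset.ne_of_mem_erase hi),
          Function.update_of_ne (Finset.ne_of_mem_erase hi)]]
  simp only [Function.update_self]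
  calc _ ≤ nnLpNorm' (2 * p i0) (f i0) * lpNormE (2 * p i0) T * _ := by
        gcongr
        exact nnLpNorm'_mul_le hp hpt (hf i0) hT fun x => (hgc x).trans_le (min_le_left _ _)
    _ = _ := by ring

theorem one_lt_sum_update_add {V : Type*} [Fintype V] [DecidableEq V] {p : V → ℝ≥0∞} {i0 : V}
    {s : ℝ≥0∞} (hp : ∀ i, 1 ≤ p i) (hsum : 1 ≤ ∑ i, (p i)⁻¹) (hs : (2 * p i0)⁻¹ < s) :
    1 < ∑ i, (Function.update p i0 (2 * p i0) i)⁻¹ + s := by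
  rw [← Finset.add_sum_erase _ _ (Finset.mem_univ i0)] at hsum
  rw [← Finset.add_sum_erase _ _ (Finset.mem_univ i0),
    Finset.sum_congr rfl (g := fun i => (p i)⁻¹)
      fun i hi => by rw [Function.update_of_ne (Finset.ne_of_mem_erase hi)], Function.update_self]
  have hfin : ∀ i, (p i)⁻¹ ≠ ∞ := fun i =>
    ENNReal.inv_ne_top.mpr (zero_lt_one.trans_le (hp i)).ne'
  have hS : ∑ i ∈ Finset.univ.erase i0, (p i)⁻¹ ≠ ∞ := ENNReal.sum_ne_top.mpr fun i _ => hfin i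
  have h2 : (2 * p i0)⁻¹ = (p i0)⁻¹ / 2 := by
    rw [ENNReal.mul_inv (by simp) (by simp), div_eq_mul_inv, mul_comm]
  calc 1 ≤ (2 * p i0)⁻¹ + ∑ i ∈ Finset.univ.erase i0, (p i)⁻¹ + (2 * p i0)⁻¹ := by
        rw [add_right_comm, h2, ENNReal.add_halves]; exact hsum
    _ < _ := ENNReal.add_lt_add_left (ENNReal.add_ne_top.mpr ⟨hs.ne_top, hS⟩) hs

theorem LpImprovingForm.sup_of_nontrivialAt_of_formUnivImproving
    (hK : Measurable fun p : EuclideanSpace ℝ (Fin d) × EuclideanSpace ℝ (Fin d) => K p.1 p.2)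
    {G₁ G₂ : SimpleGraph V} {A B : Set V} [Fintype A] [Fintype B] {i0 : V}
    (hA : i0 ∈ A) (hB : i0 ∈ B) (hAB : ∀ v, v ∈ A ∨ v ∈ B)
    (hi0 : ∀ v, v ∈ A → v ∈ B → v = i0)
    (hG₁ : ∀ i j, G₁.Adj i j → i ∈ A ∧ j ∈ A) (hG₂ : ∀ i j, G₂.Adj i j → i ∈ B ∧ j ∈ B)
    (hUniv : FormUnivImproving K (G₂.induce B))
    (hNontriv : NontrivialAt K (G₁.induce A) ⟨i0, hA⟩) :
    LpImprovingForm K (G₁ ⊔ G₂) := by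
  obtain ⟨p₁, C₁, hC₁, hp₁, hpt, hsum₁, hest₁⟩ := hNontriv
  have h1q : 1 < 2 * p₁ ⟨i0, hA⟩ :=
    lt_of_lt_of_le (by norm_num) (mul_le_mul_right (hp₁ ⟨i0, hA⟩) 2)
  obtain ⟨p₂, C₂, hC₂, hp₂, hsum₂, hest₂⟩ := hUniv ⟨i0, hB⟩ (2 * p₁ ⟨i0, hA⟩) h1q
    (ENNReal.mul_lt_top (by simp) hpt)
  set e := joinEquiv hA hB hAB hi0
  set p₁' := Function.update p₁ ⟨i0, hA⟩ (2 * p₁ ⟨i0, hA⟩)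
  have hp₁' : ∀ a, 1 ≤ p₁' a := fun a => by
    by_cases h : a = ⟨i0, hA⟩
    · subst h; simpa [p₁'] using h1q.le
    · simpa [p₁', h] using hp₁ a
  refine ⟨fun v => Sum.elim p₁' p₂ (e.symm v), C₁ * C₂, mul_pos hC₁ hC₂, fun v => ?_, ?_,
    fun f hf => ?_⟩
  · rcases h : e.symm v with a | b
    · simpa [h] using hp₁' a
    · simpa [h] using hp₂ b
  · rw [← e.sum_comp, Fintype.sum_sum_type]
    simp only [Equiv.symm_apply_apply, Sum.elim_inl, Sum.elim_inr]
    exact one_lt_sum_update_add hp₁ hsum₁ hsum₂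
  · rw [lamFormV_sup hK hA hB hAB hi0 hG₁ hG₂ hf, ← e.prod_comp, Fintype.prod_sum_type]
    simp only [Equiv.symm_apply_apply, Sum.elim_inl, Sum.elim_inr]
    refine (lintegral_mul_le_of_lamFormV_le hK (hp₁ _) hpt hest₁ (f := fun a : A => f a)
      (fun a => hf a) (measurable_Tvertex hK _ _ (f := fun b : B => f b) fun b => hf b)).trans ?_
    rw [ENNReal.ofReal_mul hC₁.le, mul_assoc]
    refine mul_le_mul' le_rfl ?_
    rw [mul_left_comm (ENNReal.ofReal C₂)]
    exact mul_le_mul' le_rfl (hest₂ (fun b => f b) fun b => hf b)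

end Joining

/-- **Joining graphs at a vertex.** Let `G₁` be a connected graph supported on the first
`n₁` vertices `{0,…,n₁-1}` of `Fin (n₁+n₂-1)` and `G₂` a connected graph supported on the
last `n₂` vertices `{n₁-1,…,n₁+n₂-2}`, so that they share exactly the vertex `n₁-1`.
If `Λ_{G₂}^K` is universally `L^p`-improving and `Λ_{G₁}^K` has a non-trivial estimate at
the common vertex, then `Λ_{G₁ ∪ G₂}^K` is `L^p`-improving. -/
theorem joining_graphs (d n₁ n₂ : ℕ) (hd : 1 ≤ d) (hn₁ : 2 ≤ n₁) (hn₂ : 2 ≤ n₂)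
    (K : EuclideanSpace ℝ (Fin d) → EuclideanSpace ℝ (Fin d) → ℝ≥0)
    (hK : Measurable fun p : EuclideanSpace ℝ (Fin d) × EuclideanSpace ℝ (Fin d) => K p.1 p.2)
    (G₁ G₂ : SimpleGraph (Fin (n₁ + n₂ - 1)))
    (hG₁sub : ∀ i j, G₁.Adj i j → (i : ℕ) < n₁ ∧ (j : ℕ) < n₁)
    (hG₂sub : ∀ i j, G₂.Adj i j → n₁ - 1 ≤ (i : ℕ) ∧ n₁ - 1 ≤ (j : ℕ))
    (hG₁conn : (G₁.induce {i : Fin (n₁ + n₂ - 1) | (i : ℕ) < n₁}).Connected)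
    (hG₂conn : (G₂.induce {i : Fin (n₁ + n₂ - 1) | n₁ - 1 ≤ (i : ℕ)}).Connected)
    (hUniv : FormUnivImproving K (G₂.induce {i : Fin (n₁ + n₂ - 1) | n₁ - 1 ≤ (i : ℕ)}))
    (hNontriv : NontrivialAt K (G₁.induce {i : Fin (n₁ + n₂ - 1) | (i : ℕ) < n₁})
      ⟨⟨n₁ - 1, by omega⟩, by simp only [Set.mem_setOf_eq]; omega⟩) :
    LpImprovingForm K (G₁ ⊔ G₂) := by
  exact LpImprovingForm.sup_of_nontrivialAt_of_formUnivImproving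
    (A := {i : Fin (n₁ + n₂ - 1) | (i : ℕ) < n₁}) (B := {i : Fin (n₁ + n₂ - 1) | n₁ - 1 ≤ (i : ℕ)})
    (i0 := ⟨n₁ - 1, by omega⟩) hK (by simp; omega) (by simp; omega)
    (fun v => by simp only [Set.mem_ofPred_eq]; omega)
    (fun v h1 h2 => by simp only [Set.mem_ofPred_eq] at h1 h2; ext; simp only; omega)
    hG₁sub hG₂sub hUniv hNontriv
end
end
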